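/- arXiv:1307.1978 — 2 statements merged into one kernel-verified Lean document; each statement's English description precedes it below -/
import Mathlib

section
/- If (φ₀,φ₁) ≢ 0, then 0 < τ₀ < ∞; that is, the set B is nonempty and the infimum τ₀ = inf_{(σ,θ)∈B} G₀(σ,θ) is a finite strictly positive number. -/
open Real MeasureTheory Filter Topology Asymptotics

noncomputable section

/-- Partial derivative in the `i`-th coordinate direction on `Fin 3 → ℝ`
(coordinates `y = (t, x₁, x₂)`). -/
def pd (i : Fin 3) (f : (Fin 3 → ℝ) → ℝ) : (Fin 3 → ℝ) → ℝ :=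
  fun y => fderiv ℝ f y (Pi.single i 1)

/-- Radon transform of `v : ℝ² → ℝ` over the line `x · ω = s`, where
`ω = (cos θ, sin θ)`. -/
def radon (v : ℝ × ℝ → ℝ) (s θ : ℝ) : ℝ :=
  ∫ t : ℝ, v (s * Real.cos θ - t * Real.sin θ, s * Real.sin θ + t * Real.cos θ)

/-- `ω̂ = (-1, cos θ, sin θ)`. -/
def omegaHat (θ : ℝ) : Fin 3 → ℝ := ![(-1 : ℝ), Real.cos θ, Real.sin θ]

/-- The Friedlander radiation field `F₀` associated with the data `(φ₀, φ₁)`. -/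
def F0 (φ0 φ1 : ℝ × ℝ → ℝ) (σ θ : ℝ) : ℝ :=
  (1 / (2 * Real.pi * Real.sqrt 2)) *
    ∫ s in Set.Ioi σ,
      (radon φ1 s θ - deriv (fun s' => radon φ0 s' θ) s) / Real.sqrt (s - σ)

/-- `F₁(σ,θ) = (Σ d_ij ω̂_i ω̂_j) ∂_σ F₀(σ,θ)`. -/
def F1 (d : Fin 3 → Fin 3 → ℝ) (φ0 φ1 : ℝ × ℝ → ℝ) (σ θ : ℝ) : ℝ :=
  (∑ i : Fin 3, ∑ j : Fin 3, d i j * omegaHat θ i * omegaHat θ j) *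
    deriv (fun σ' => F0 φ0 φ1 σ' θ) σ

/-- `F₂(σ,θ) = (Σ e_ij^k ω̂_i ω̂_j ω̂_k) ∂²_σ F₀(σ,θ)`. -/
def F2 (e : Fin 3 → Fin 3 → Fin 3 → ℝ) (φ0 φ1 : ℝ × ℝ → ℝ) (σ θ : ℝ) : ℝ :=
  (∑ i : Fin 3, ∑ j : Fin 3, ∑ k : Fin 3,
      e i j k * omegaHat θ i * omegaHat θ j * omegaHat θ k) *
    deriv (fun σ' => deriv (fun σ'' => F0 φ0 φ1 σ'' θ) σ') σ

/-- `G₀(σ,θ) = (1/F₁) log(1 + F₁/F₂)`. -/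
def G0 (d : Fin 3 → Fin 3 → ℝ) (e : Fin 3 → Fin 3 → Fin 3 → ℝ)
    (φ0 φ1 : ℝ × ℝ → ℝ) (σ θ : ℝ) : ℝ :=
  (1 / F1 d φ0 φ1 σ θ) * Real.log (1 + F1 d φ0 φ1 σ θ / F2 e φ0 φ1 σ θ)

/-- The set `A`. -/
def setA (M : ℝ) (d : Fin 3 → Fin 3 → ℝ) (e : Fin 3 → Fin 3 → Fin 3 → ℝ)
    (φ0 φ1 : ℝ × ℝ → ℝ) : Set (ℝ × ℝ) :=
  {p | p.1 < M ∧ p.2 ∈ Set.Icc 0 (2 * Real.pi) ∧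
    F1 d φ0 φ1 p.1 p.2 ≠ 0 ∧ F2 e φ0 φ1 p.1 p.2 ≠ 0 ∧
    0 < 1 + F1 d φ0 φ1 p.1 p.2 / F2 e φ0 φ1 p.1 p.2}

/-- The set `B = {(σ,θ) ∈ A : G₀(σ,θ) > 0}`. -/
def setB (M : ℝ) (d : Fin 3 → Fin 3 → ℝ) (e : Fin 3 → Fin 3 → Fin 3 → ℝ)
    (φ0 φ1 : ℝ × ℝ → ℝ) : Set (ℝ × ℝ) :=
  {p ∈ setA M d e φ0 φ1 | 0 < G0 d e φ0 φ1 p.1 p.2}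

/-- `τ₀ = inf_{(σ,θ) ∈ B} G₀(σ,θ)`. -/
def tau0 (M : ℝ) (d : Fin 3 → Fin 3 → ℝ) (e : Fin 3 → Fin 3 → Fin 3 → ℝ)
    (φ0 φ1 : ℝ × ℝ → ℝ) : ℝ :=
  sInf ((fun p : ℝ × ℝ => G0 d e φ0 φ1 p.1 p.2) '' setB M d e φ0 φ1)

/-- The set `D = {(σ,θ) : σ < M, F₁ = 0, F₂ > 0}`. -/
def setD (M : ℝ) (d : Fin 3 → Fin 3 → ℝ) (e : Fin 3 → Fin 3 → Fin 3 → ℝ)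
    (φ0 φ1 : ℝ × ℝ → ℝ) : Set (ℝ × ℝ) :=
  {p | p.1 < M ∧ p.2 ∈ Set.Icc 0 (2 * Real.pi) ∧
    F1 d φ0 φ1 p.1 p.2 = 0 ∧ 0 < F2 e φ0 φ1 p.1 p.2}

/-- `φ` is supported in the closed disk of radius `M` centered at the origin. -/
def SuppIn (M : ℝ) (φ : ℝ × ℝ → ℝ) : Prop :=
  ∀ x : ℝ × ℝ, M ^ 2 < x.1 ^ 2 + x.2 ^ 2 → φ x = 0

/-- The cubic form `Σ e_ij^k ξ_i ξ_j ξ_k` does not satisfy the null condition: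
it does not vanish identically on the light cone. -/
def NullCondFails (e : Fin 3 → Fin 3 → Fin 3 → ℝ) : Prop :=
  ∃ ξ : Fin 3 → ℝ, ξ 0 ^ 2 = ξ 1 ^ 2 + ξ 2 ^ 2 ∧ (ξ 1 ≠ 0 ∨ ξ 2 ≠ 0) ∧
    (∑ i : Fin 3, ∑ j : Fin 3, ∑ k : Fin 3, e i j k * ξ i * ξ j * ξ k) ≠ 0

/-- Hessian (as a 2×2 matrix) of a function of two real variables. -/
def hessCurried (f : ℝ → ℝ → ℝ) (σ θ : ℝ) : Matrix (Fin 2) (Fin 2) ℝ :=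
  !![deriv (fun a => deriv (fun b => f b θ) a) σ,
     deriv (fun a => deriv (fun b => f a b) θ) σ;
     deriv (fun b => deriv (fun a => f a b) σ) θ,
     deriv (fun b => deriv (fun b' => f σ b') b) θ]

/-- Minkowski coefficients: `Σ c_ij ∂_ij = ∂_t² - Δ`. -/
def cMink : Fin 3 → Fin 3 → ℝ := fun i j =>
  if i = j then (if i = 0 then 1 else -1) else 0

/-- `u` is a `C^∞` solution of problem (1.1) on `[0,T) × ℝ²`. -/
def IsSol (g : Fin 3 → Fin 3 → ℝ → (Fin 3 → ℝ) → ℝ) (ε : ℝ)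
    (φ0 φ1 : ℝ × ℝ → ℝ) (u : (Fin 3 → ℝ) → ℝ) (T : ℝ) : Prop :=
  ContDiffOn ℝ (⊤ : ℕ∞) u {y | 0 ≤ y 0 ∧ y 0 < T} ∧
  (∀ y : Fin 3 → ℝ, 0 ≤ y 0 → y 0 < T →
    ∑ i : Fin 3, ∑ j : Fin 3,
      g i j (u y) (fun k => pd k u y) * pd i (pd j u) y = 0) ∧
  (∀ x : ℝ × ℝ, u ![0, x.1, x.2] = ε * φ0 x ∧ pd 0 u ![0, x.1, x.2] = ε * φ1 x)

/-- The lifespan `T_ε`: the supremum of times of existence of smooth solutions. -/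
def lifespan (g : Fin 3 → Fin 3 → ℝ → (Fin 3 → ℝ) → ℝ) (ε : ℝ)
    (φ0 φ1 : ℝ × ℝ → ℝ) : ℝ :=
  sSup {T : ℝ | ∃ u, IsSol g ε φ0 φ1 u T}

/-- `V` is a `C^∞` solution of the profile problem (2.1) on `ℝ × S¹ × [0, τmax)`. -/
def IsProfileSol (M : ℝ) (d : Fin 3 → Fin 3 → ℝ) (e : Fin 3 → Fin 3 → Fin 3 → ℝ)
    (φ0 φ1 : ℝ × ℝ → ℝ) (τmax : ℝ) (V : ℝ → ℝ → ℝ → ℝ) : Prop :=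
  ContDiffOn ℝ (⊤ : ℕ∞) (fun p : ℝ × ℝ × ℝ => V p.1 p.2.1 p.2.2)
    {p : ℝ × ℝ × ℝ | 0 ≤ p.2.2 ∧ p.2.2 < τmax} ∧
  (∀ q θ τ : ℝ, V q (θ + 2 * Real.pi) τ = V q θ τ) ∧
  (∀ q θ τ : ℝ, M < q → V q θ τ = 0) ∧
  (∀ q θ : ℝ, V q θ 0 = F0 φ0 φ1 q θ) ∧
  (∀ q θ τ : ℝ, 0 ≤ τ → τ < τmax →
    deriv (fun τ' => deriv (fun q' => V q' θ τ') q) τ -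
      ∑ i : Fin 3, ∑ j : Fin 3,
        (d i j * V q θ τ +
          ∑ k : Fin 3, e i j k * omegaHat θ k * deriv (fun q' => V q' θ τ) q) *
        omegaHat θ i * omegaHat θ j *
        deriv (fun q' => deriv (fun q'' => V q'' θ τ) q') q = 0)

/-- The Jacobian `∂_s q` of the characteristic flow. -/
def kfun (d : Fin 3 → Fin 3 → ℝ) (e : Fin 3 → Fin 3 → Fin 3 → ℝ)
    (φ0 φ1 : ℝ × ℝ → ℝ) (ρ θ τ : ℝ) : ℝ :=
  if F1 d φ0 φ1 ρ θ = 0 then 1 - τ * F2 e φ0 φ1 ρ θ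
  else Real.exp (-τ * F1 d φ0 φ1 ρ θ) * (1 + F2 e φ0 φ1 ρ θ / F1 d φ0 φ1 ρ θ)
        - F2 e φ0 φ1 ρ θ / F1 d φ0 φ1 ρ θ

/-- Partial derivatives on `ℝ × ℝ × ℝ` (coordinates `(s, θ, τ)`). -/
def pd3 : Fin 3 → (ℝ × ℝ × ℝ → ℝ) → ℝ × ℝ × ℝ → ℝ :=
  ![fun f p => deriv (fun a => f (a, p.2.1, p.2.2)) p.1,
    fun f p => deriv (fun a => f (p.1, a, p.2.2)) p.2.1,
    fun f p => deriv (fun a => f (p.1, p.2.1, a)) p.2.2]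

/-- Hessian in the first two variables `(s, θ)` of a function on `ℝ × ℝ × ℝ`. -/
def hessST (f : ℝ × ℝ × ℝ → ℝ) (p : ℝ × ℝ × ℝ) : Matrix (Fin 2) (Fin 2) ℝ :=
  !![pd3 0 (pd3 0 f) p, pd3 0 (pd3 1 f) p;
     pd3 1 (pd3 0 f) p, pd3 1 (pd3 1 f) p]

/-- The Klainerman vector fields on `ℝ_t × ℝ²`:
`∂_t, ∂_1, ∂_2, S = t∂_t + x₁∂_1 + x₂∂_2, H₁, H₂, R`. -/
def KOp : Fin 7 → ((Fin 3 → ℝ) → ℝ) → (Fin 3 → ℝ) → ℝ :=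
  ![fun f => pd 0 f,
    fun f => pd 1 f,
    fun f => pd 2 f,
    fun f y => y 0 * pd 0 f y + y 1 * pd 1 f y + y 2 * pd 2 f y,
    fun f y => y 1 * pd 0 f y + y 0 * pd 1 f y,
    fun f y => y 2 * pd 0 f y + y 0 * pd 2 f y,
    fun f y => y 1 * pd 2 f y - y 2 * pd 1 f y]

/-- `Z^α`: iterated product of Klainerman vector fields indexed by a list. -/
def Zpow (α : List (Fin 7)) (f : (Fin 3 → ℝ) → ℝ) : (Fin 3 → ℝ) → ℝ :=
  α.foldr (fun i acc => KOp i acc) f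

end

/-- Differentiation under the integral sign with locally uniform compact support. -/
lemma aux_hasDerivAt_integral (f f' : ℝ → ℝ → ℝ)
    (hf : Continuous (fun p : ℝ × ℝ => f p.1 p.2))
    (hf' : Continuous (fun p : ℝ × ℝ => f' p.1 p.2))
    (hd : ∀ s t, HasDerivAt (fun s => f s t) (f' s t) s)
    (s0 R : ℝ)
    (hz : ∀ s t, |s - s0| ≤ 1 → R < |t| → f s t = 0)
    (hz' : ∀ s t, |s - s0| ≤ 1 → R < |t| → f' s t = 0) :
    HasDerivAt (fun s => ∫ t, f s t) (∫ t, f' s0 t) s0 := by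
  have hcpt : IsCompact ((Metric.closedBall s0 1) ×ˢ (Set.Icc (-R) R)) :=
    (isCompact_closedBall s0 1).prod isCompact_Icc
  obtain ⟨C, hC⟩ := hcpt.exists_bound_of_continuousOn hf'.continuousOn
  have hcont : ∀ s, Continuous (f s) := fun s => hf.comp (by fun_prop : Continuous fun t : ℝ => (s, t))
  have hcont' : ∀ s, Continuous (f' s) := fun s => hf'.comp (by fun_prop : Continuous fun t : ℝ => (s, t))
  have hcs : HasCompactSupport (f s0) := by
    refine HasCompactSupport.intro (isCompact_Icc (a := -R) (b := R)) ?_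
    intro t ht
    apply hz s0 t (by simp)
    by_contra hh
    exact ht (abs_le.mp (not_lt.mp hh))
  refine (hasDerivAt_integral_of_dominated_loc_of_deriv_le (μ := volume)
    (F := f) (F' := f') (x₀ := s0) (s := Metric.ball s0 1)
    (bound := (Set.Icc (-R) R).indicator (fun _ => C))
    (Metric.ball_mem_nhds s0 one_pos) ?_ ?_ ?_ ?_ ?_ ?_).2
  · exact Eventually.of_forall fun s => (hcont s).aestronglyMeasurable
  · exact (hcont s0).integrable_of_hasCompactSupport hcs
  · exact (hcont' s0).aestronglyMeasurable
  · refine Eventually.of_forall fun t s hs => ?_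
    have hs' : |s - s0| ≤ 1 := by
      have := Metric.mem_ball.mp hs
      rw [Real.dist_eq] at this
      exact this.le
    by_cases ht : t ∈ Set.Icc (-R) R
    · rw [Set.indicator_of_mem ht]
      exact hC (s, t) ⟨Metric.ball_subset_closedBall hs, ht⟩
    · rw [Set.indicator_of_notMem ht, hz' s t hs']
      · simp
      · by_contra hh
        exact ht (abs_le.mp (not_lt.mp hh))
  · exact (integrable_indicator_iff measurableSet_Icc).mpr (by simp)
  · exact Eventually.of_forall fun t s _ => hd s t

/-- Smooth functions of `(θ, s, t)` supported in `s² + t² ≤ M²`. -/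
structure AuxNice (M : ℝ) (G : ℝ × ℝ × ℝ → ℝ) : Prop where
  smooth : ContDiff ℝ (⊤ : ℕ∞) G
  supp : ∀ p : ℝ × ℝ × ℝ, M ^ 2 < p.2.1 ^ 2 + p.2.2 ^ 2 → G p = 0

/-- The function `φ` in rotated coordinates. -/
noncomputable def auxRot (φ : ℝ × ℝ → ℝ) : ℝ × ℝ × ℝ → ℝ := fun p =>
  φ (p.2.1 * Real.cos p.1 - p.2.2 * Real.sin p.1, p.2.1 * Real.sin p.1 + p.2.2 * Real.cos p.1)

/-- Derivative in `s`. -/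
noncomputable def auxDS (G : ℝ × ℝ × ℝ → ℝ) : ℝ × ℝ × ℝ → ℝ := fun p => fderiv ℝ G p (0, 1, 0)

/-- Integration in `t`. -/
noncomputable def auxI (G : ℝ × ℝ × ℝ → ℝ) (s θ : ℝ) : ℝ := ∫ t : ℝ, G (θ, s, t)

lemma auxNice_rot {M : ℝ} {φ : ℝ × ℝ → ℝ} (h : ContDiff ℝ (⊤ : ℕ∞) φ) (hs : SuppIn M φ) :
    AuxNice M (auxRot φ) := by
  constructor
  · unfold auxRot
    apply h.comp
    have h1 : ContDiff ℝ (⊤ : ℕ∞) (fun p : ℝ × ℝ × ℝ => Real.cos p.1) := Real.contDiff_cos.comp contDiff_fst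
    have h2 : ContDiff ℝ (⊤ : ℕ∞) (fun p : ℝ × ℝ × ℝ => Real.sin p.1) := Real.contDiff_sin.comp contDiff_fst
    fun_prop
  · intro p hp
    apply hs
    have := Real.sin_sq_add_cos_sq p.1
    simp only
    have e : (p.2.1 * Real.cos p.1 - p.2.2 * Real.sin p.1) ^ 2
      + (p.2.1 * Real.sin p.1 + p.2.2 * Real.cos p.1) ^ 2
      = (p.2.1 ^ 2 + p.2.2 ^ 2) * (Real.sin p.1 ^ 2 + Real.cos p.1 ^ 2) := by ring
    rw [e, this, mul_one]
    exact hp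

lemma auxNice_sub {M : ℝ} {G H : ℝ × ℝ × ℝ → ℝ} (hG : AuxNice M G) (hH : AuxNice M H) :
    AuxNice M (fun p => G p - H p) :=
  ⟨hG.smooth.sub hH.smooth, fun p hp => by rw [hG.supp p hp, hH.supp p hp, sub_zero]⟩

lemma auxNice_dS {M : ℝ} {G : ℝ × ℝ × ℝ → ℝ} (hG : AuxNice M G) : AuxNice M (auxDS G) := by
  constructor
  · have h1 : ContDiff ℝ (⊤ : ℕ∞) (fderiv ℝ G) := hG.smooth.fderiv_right (by simp)
    exact h1.clm_apply contDiff_const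
  · intro p hp
    have hopen : IsOpen {p : ℝ × ℝ × ℝ | M ^ 2 < p.2.1 ^ 2 + p.2.2 ^ 2} :=
      isOpen_lt continuous_const (by fun_prop)
    have : G =ᶠ[𝓝 p] fun _ => 0 := by
      filter_upwards [hopen.mem_nhds hp] with q hq using hG.supp q hq
    simp [auxDS, this.fderiv_eq]

lemma auxNice_hasDeriv {M : ℝ} {G : ℝ × ℝ × ℝ → ℝ} (hG : AuxNice M G) (θ s t : ℝ) :
    HasDerivAt (fun s => G (θ, s, t)) (auxDS G (θ, s, t)) s := by
  have h1 : HasFDerivAt G (fderiv ℝ G (θ, s, t)) (θ, s, t) :=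
    (hG.smooth.differentiable (by simp) _).hasFDerivAt
  have h2 : HasDerivAt (fun s : ℝ => ((θ, s, t) : ℝ × ℝ × ℝ)) (0, 1, 0) s :=
    (hasDerivAt_const s θ).prodMk ((hasDerivAt_id s).prodMk (hasDerivAt_const s t))
  exact h1.comp_hasDerivAt s h2

lemma aux_sq_lt {M s t : ℝ} (hM : 0 < M) (h : M < |t|) : M ^ 2 < s ^ 2 + t ^ 2 := by
  have : M ^ 2 < |t| ^ 2 := by gcongr
  rw [sq_abs] at this
  nlinarith [sq_nonneg s]

lemma auxI_hasDeriv {M : ℝ} (hM : 0 < M) {G : ℝ × ℝ × ℝ → ℝ} (hG : AuxNice M G) (θ s : ℝ) :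
    HasDerivAt (fun s => auxI G s θ) (auxI (auxDS G) s θ) s := by
  have hc := hG.smooth.continuous
  have hc' := (auxNice_dS hG).smooth.continuous
  refine aux_hasDerivAt_integral (fun s t => G (θ, s, t)) (fun s t => auxDS G (θ, s, t))
    (by fun_prop) (by fun_prop) (fun s t => auxNice_hasDeriv hG θ s t) s M ?_ ?_
  · intro s t _ ht
    exact hG.supp _ (aux_sq_lt hM ht)
  · intro s t _ ht
    exact (auxNice_dS hG).supp _ (aux_sq_lt hM ht)

lemma auxI_supp {M : ℝ} (hM : 0 < M) {G : ℝ × ℝ × ℝ → ℝ} (hG : AuxNice M G) {s : ℝ} (θ : ℝ)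
    (hs : M < |s|) : auxI G s θ = 0 := by
  unfold auxI
  have : ∀ t, G (θ, s, t) = 0 := fun t =>
    hG.supp _ (by have := aux_sq_lt (s := t) hM hs; simp only; linarith)
  simp [this]

lemma auxI_cont {M : ℝ} (hM : 0 < M) {G : ℝ × ℝ × ℝ → ℝ} (hG : AuxNice M G) :
    Continuous (fun p : ℝ × ℝ => auxI G p.1 p.2) := by
  have hc := hG.smooth.continuous
  have : (fun p : ℝ × ℝ => auxI G p.1 p.2)
      = fun p : ℝ × ℝ => ∫ t in Set.Icc (-M) M, G (p.2, p.1, t) := by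
    funext p
    unfold auxI
    rw [setIntegral_eq_integral_of_forall_compl_eq_zero]
    intro t ht
    apply hG.supp
    apply aux_sq_lt hM
    by_contra hh
    exact ht (abs_le.mp (not_lt.mp hh))
  rw [this]
  exact continuous_parametric_integral_of_continuous
    (f := fun (p : ℝ × ℝ) (t : ℝ) => G (p.2, p.1, t))
    (by unfold Function.uncurry; fun_prop) isCompact_Icc

lemma auxI_bound {M : ℝ} (hM : 0 < M) {G : ℝ × ℝ × ℝ → ℝ} (hG : AuxNice M G) :
    ∃ C, 0 ≤ C ∧ ∀ s θ, θ ∈ Set.Icc 0 (2 * Real.pi) → |auxI G s θ| ≤ C := by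
  have hcpt : IsCompact ((Set.Icc (-M) M) ×ˢ (Set.Icc 0 (2 * Real.pi))) :=
    isCompact_Icc.prod isCompact_Icc
  obtain ⟨C, hC⟩ := hcpt.exists_bound_of_continuousOn (auxI_cont hM hG).continuousOn
  refine ⟨max C 0, le_max_right _ _, fun s θ hθ => ?_⟩
  by_cases hs : M < |s|
  · rw [auxI_supp hM hG θ hs]; simp
  · exact (hC (s, θ) ⟨abs_le.mp (not_lt.mp hs), hθ⟩).trans (le_max_left _ _)

lemma aux_radon (φ : ℝ × ℝ → ℝ) (s θ : ℝ) : radon φ s θ = auxI (auxRot φ) s θ := rfl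

lemma auxI_sub {M : ℝ} (hM : 0 < M) {G H : ℝ × ℝ × ℝ → ℝ} (hG : AuxNice M G) (hH : AuxNice M H)
    (s θ : ℝ) : auxI (fun p => G p - H p) s θ = auxI G s θ - auxI H s θ := by
  have key : ∀ {G : ℝ × ℝ × ℝ → ℝ}, AuxNice M G → Integrable (fun t : ℝ => G (θ, s, t)) := by
    intro G hG
    have hc := hG.smooth.continuous
    refine Continuous.integrable_of_hasCompactSupport (by fun_prop) ?_
    refine HasCompactSupport.intro (isCompact_Icc (a := -M) (b := M)) ?_
    intro t ht
    apply hG.supp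
    apply aux_sq_lt hM
    by_contra hh
    exact ht (abs_le.mp (not_lt.mp hh))
  exact integral_sub (key hG) (key hH)

/-- The half integral. -/
noncomputable def auxJ (h : ℝ → ℝ) (σ : ℝ) : ℝ := ∫ x : ℝ, h (σ + x ^ 2)

lemma auxJ_eq (h : ℝ → ℝ) (σ : ℝ) :
    ∫ s in Set.Ioi σ, h s / Real.sqrt (s - σ) = auxJ h σ := by
  have h1 : ∫ s in Set.Ioi σ, h s / Real.sqrt (s - σ)
      = ∫ u in Set.Ioi 0, h (σ + u) / Real.sqrt u := by
    have := (measurePreserving_add_left volume σ).setIntegral_preimage_emb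
      (measurableEmbedding_addLeft σ) (fun s => h s / Real.sqrt (s - σ)) (Set.Ioi σ)
    simpa using this.symm
  have h2 := integral_comp_rpow_Ioi_of_pos (g := fun u => h (σ + u) / Real.sqrt u)
    (p := 2) (by norm_num)
  rw [h1, ← h2]
  unfold auxJ
  have h3 := integral_comp_abs (f := fun x => h (σ + x ^ 2))
  simp only [sq_abs] at h3
  rw [h3, ← integral_const_mul]
  apply setIntegral_congr_fun measurableSet_Ioi
  intro x hx
  have hx : 0 < x := hx
  have e1 : x ^ (2:ℝ) = x ^ 2 := by norm_cast
  have e2 : x ^ ((2:ℝ) - 1) = x := by norm_num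
  simp only [smul_eq_mul, e1, e2, Real.sqrt_sq hx.le]
  field_simp

lemma auxJ_hasDeriv {M : ℝ} {h h' : ℝ → ℝ} (hh' : Continuous h')
    (hd : ∀ s, HasDerivAt h (h' s) s) (hz : ∀ s, M < |s| → h s = 0)
    (hz' : ∀ s, M < |s| → h' s = 0) (σ : ℝ) : HasDerivAt (auxJ h) (auxJ h' σ) σ := by
  have hc : Continuous h := continuous_iff_continuousAt.mpr fun s => (hd s).continuousAt
  have key : ∀ s t : ℝ, |s - σ| ≤ 1 → |M| + |σ| + 1 < |t| → M < |s + t ^ 2| := by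
    intro s t hs ht
    have h1 := abs_le.mp hs
    have h2 : t ^ 2 = |t| ^ 2 := (sq_abs t).symm
    have h3 : |t| ≤ |t| ^ 2 := by nlinarith [abs_nonneg M, abs_nonneg σ]
    refine lt_of_lt_of_le ?_ (le_abs_self _)
    have := neg_abs_le σ
    have := le_abs_self M
    linarith
  refine aux_hasDerivAt_integral (fun s x => h (s + x ^ 2)) (fun s x => h' (s + x ^ 2))
    (by fun_prop) (by fun_prop) (fun s x => ?_) σ (|M| + |σ| + 1) ?_ ?_
  · exact (hd (s + x ^ 2)).comp_add_const s (x ^ 2)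
  · intro s t hs ht
    exact hz _ (key s t hs ht)
  · intro s t hs ht
    exact hz' _ (key s t hs ht)

lemma auxJ_bound {M C : ℝ} (hM : 0 ≤ M) (hC : 0 ≤ C) {h : ℝ → ℝ} (hb : ∀ s, |h s| ≤ C)
    (hz : ∀ s, M < |s| → h s = 0) (σ : ℝ) :
    |auxJ h σ| ≤ C * (2 * (Real.sqrt (M - σ) - Real.sqrt (-M - σ))) := by
  set a := Real.sqrt (-M - σ)
  set b := Real.sqrt (M - σ)
  have hab : a ≤ b := Real.sqrt_le_sqrt (by linarith)
  have ha : 0 ≤ a := Real.sqrt_nonneg _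
  set S : Set ℝ := Set.Icc (-b) (-a) ∪ Set.Icc a b
  have hS : ∀ x, x ∉ S → h (σ + x ^ 2) = 0 := by
    intro x hx
    apply hz
    by_contra hcon
    have h1 := abs_le.mp (not_lt.mp hcon)
    have hxa : a ≤ |x| := by
      rw [← Real.sqrt_sq_eq_abs]; exact Real.sqrt_le_sqrt (by linarith)
    have hxb : |x| ≤ b := by
      rw [← Real.sqrt_sq_eq_abs]; exact Real.sqrt_le_sqrt (by linarith)
    apply hx
    rcases abs_cases x with ⟨h2, _⟩ | ⟨h2, _⟩
    · right; rw [h2] at hxa hxb; exact ⟨hxa, hxb⟩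
    · left; rw [h2] at hxa hxb; exact ⟨by linarith, by linarith⟩
  have hvol : volume S ≤ ENNReal.ofReal (2 * (b - a)) := by
    refine (measure_union_le _ _).trans ?_
    rw [Real.volume_Icc, Real.volume_Icc, ← ENNReal.ofReal_add (by linarith) (by linarith)]
    apply ENNReal.ofReal_le_ofReal
    linarith
  have hreal : volume.real S ≤ 2 * (b - a) := by
    refine ENNReal.toReal_le_of_le_ofReal (by linarith) hvol
  unfold auxJ
  rw [← setIntegral_eq_integral_of_forall_compl_eq_zero hS]
  have := norm_setIntegral_le_of_norm_le_const (μ := volume) (s := S) (C := C)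
    (f := fun x => h (σ + x ^ 2)) (lt_of_le_of_lt hvol ENNReal.ofReal_lt_top)
    (fun x _ => hb _)
  refine this.trans ?_
  gcongr

lemma auxJ_inj {M : ℝ} {h h' : ℝ → ℝ} (hh' : Continuous h')
    (hd : ∀ s, HasDerivAt h (h' s) s) (hz : ∀ s, M < |s| → h s = 0)
    (hz' : ∀ s, M < |s| → h' s = 0) (hJ : ∀ σ, auxJ h σ = 0) (σ : ℝ) : h σ = 0 := by
  have hJ' : ∀ σ, auxJ h' σ = 0 := by
    intro σ
    have h1 := auxJ_hasDeriv hh' hd hz hz' σ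
    have : auxJ h = fun _ => 0 := funext hJ
    rw [this] at h1
    exact h1.unique (hasDerivAt_const σ 0)
  set R : ℝ := |M| + |σ| + 1 with hR
  have hR0 : 0 < R := by positivity
  have hbig : ∀ w : ℝ, R ≤ w → M < |σ + w| := by
    intro w hw
    refine lt_of_lt_of_le ?_ (le_abs_self _)
    have := neg_abs_le σ
    have := le_abs_self M
    linarith
  have hsq : ∀ t : ℝ, R < |t| → R ≤ t ^ 2 := by
    intro t ht
    rw [← sq_abs]
    nlinarith [abs_nonneg M, abs_nonneg σ]
  have hint : Integrable (fun p : ℝ × ℝ => h' (σ + p.1 ^ 2 + p.2 ^ 2)) := by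
    refine Continuous.integrable_of_hasCompactSupport (by fun_prop) ?_
    refine HasCompactSupport.intro
      ((isCompact_Icc (a := -R) (b := R)).prod (isCompact_Icc (a := -R) (b := R))) ?_
    intro p hp
    apply hz'
    rw [add_assoc]
    apply hbig
    by_cases h1 : R < |p.1|
    · nlinarith [hsq _ h1, sq_nonneg p.2]
    · by_cases h2 : R < |p.2|
      · nlinarith [hsq _ h2, sq_nonneg p.1]
      · exact absurd ⟨abs_le.mp (not_lt.mp h1), abs_le.mp (not_lt.mp h2)⟩ hp
  have e1 : ∫ p : ℝ × ℝ, h' (σ + p.1 ^ 2 + p.2 ^ 2) = 0 := by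
    rw [Measure.volume_eq_prod, integral_prod _ hint]
    have : ∀ x : ℝ, ∫ y : ℝ, h' (σ + x ^ 2 + y ^ 2) = 0 := fun x => hJ' (σ + x ^ 2)
    simp [this]
  have e2 := integral_comp_polarCoord_symm (fun p : ℝ × ℝ => h' (σ + p.1 ^ 2 + p.2 ^ 2))
  rw [e1] at e2
  have e3 : ∀ p : ℝ × ℝ, p.1 • h' (σ + (polarCoord.symm p).1 ^ 2 + (polarCoord.symm p).2 ^ 2)
      = (p.1 * h' (σ + p.1 ^ 2)) * 1 := by
    intro p
    have := Real.sin_sq_add_cos_sq p.2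
    have e : σ + (p.1 * Real.cos p.2) ^ 2 + (p.1 * Real.sin p.2) ^ 2
        = σ + p.1 ^ 2 * (Real.sin p.2 ^ 2 + Real.cos p.2 ^ 2) := by ring
    simp only [polarCoord_symm_apply, smul_eq_mul, e, this, mul_one]
  simp only [e3] at e2
  have ht : polarCoord.target = Set.Ioi (0:ℝ) ×ˢ Set.Ioo (-Real.pi) Real.pi := rfl
  rw [ht, Measure.volume_eq_prod,
    setIntegral_prod_mul (fun r : ℝ => r * h' (σ + r ^ 2)) (fun _ : ℝ => (1:ℝ))] at e2
  have e4 : ∫ r in Set.Ioi (0:ℝ), r * h' (σ + r ^ 2) = 0 - (1/2) * h (σ + 0 ^ 2) := by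
    refine integral_Ioi_of_hasDerivAt_of_tendsto' (f := fun r => (1/2) * h (σ + r ^ 2)) ?_ ?_ ?_
    · intro r _
      have h1 : HasDerivAt (fun r : ℝ => σ + r ^ 2) (2 * r) r := by
        simpa using (hasDerivAt_pow 2 r).const_add σ
      have := ((hd (σ + r ^ 2)).comp r h1).const_mul (1/2)
      have e : 1 / 2 * (h' (σ + r ^ 2) * (2 * r)) = r * h' (σ + r ^ 2) := by ring
      rw [e] at this
      exact this
    · refine Integrable.integrableOn ?_
      refine Continuous.integrable_of_hasCompactSupport (by fun_prop) ?_
      refine HasCompactSupport.intro (isCompact_Icc (a := -R) (b := R)) ?_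
      intro t ht
      rw [hz', mul_zero]
      apply hbig
      apply hsq
      by_contra hh
      exact ht (abs_le.mp (not_lt.mp hh))
    · refine tendsto_const_nhds.congr' ?_
      filter_upwards [eventually_gt_atTop R] with r hr
      rw [hz, mul_zero]
      exact hbig _ (hsq _ (lt_of_lt_of_le hr (le_abs_self r)))
  rw [e4] at e2
  have hpi := Real.pi_pos
  have e5 : ∫ _x in Set.Ioo (-Real.pi) Real.pi, (1:ℝ) = 2 * Real.pi := by
    simp [Real.volume_real_Ioo_of_le (by linarith : -Real.pi ≤ Real.pi)]
    ring
  rw [e5] at e2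
  have : h (σ + 0 ^ 2) = h σ := by norm_num
  rw [this] at e2
  rcases mul_eq_zero.mp e2 with h | h
  · linarith
  · linarith

lemma aux_mvt {q q' : ℝ → ℝ} (hq : ∀ x, HasDerivAt q (q' x) x) {a b k : ℝ} (hab : a < b)
    (ha : q a ≤ k) (hb : k < q b) : ∃ x, k < q x ∧ 0 < q' x := by
  have hc : Continuous q := continuous_iff_continuousAt.mpr fun s => (hq s).continuousAt
  have hcpt : IsCompact (Set.Icc a b ∩ {x | q x ≤ k}) :=
    isCompact_Icc.inter_right (isClosed_le hc continuous_const)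
  obtain ⟨c, ⟨⟨hac, hcb⟩, hck⟩, hmax⟩ := hcpt.exists_isGreatest ⟨a, ⟨le_refl _, hab.le⟩, ha⟩
  have hck : q c ≤ k := hck
  have hcb' : c < b := lt_of_le_of_ne hcb (by rintro rfl; linarith)
  obtain ⟨x, hx, hxe⟩ := exists_hasDerivAt_eq_slope q q' hcb' hc.continuousOn (fun x _ => hq x)
  refine ⟨x, ?_, ?_⟩
  · by_contra hh
    have := hmax ⟨⟨hac.trans hx.1.le, hx.2.le⟩, not_lt.mp hh⟩
    linarith [hx.1]
  · rw [hxe]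
    apply div_pos <;> linarith

/-- Sign lemma. -/
lemma aux_sign {M : ℝ} {f q q' : ℝ → ℝ} (hf : ∀ x, HasDerivAt f (q x) x)
    (hq : ∀ x, HasDerivAt q (q' x) x) (hf0 : Tendsto f atBot (𝓝 0))
    (hq0 : Tendsto q atBot (𝓝 0)) (hfM : ∀ x, M ≤ x → f x = 0) (hqM : ∀ x, M ≤ x → q x = 0)
    (hne : ∃ x, f x ≠ 0) :
    (∃ x, 0 < q x ∧ 0 < q' x) ∧ (∃ x, q x < 0 ∧ 0 < q' x) := by
  have hdiff : Differentiable ℝ f := fun x => (hf x).differentiableAt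
  have hderiv : ∀ x, deriv f x = q x := fun x => (hf x).deriv
  obtain ⟨x0, hx0⟩ := hne
  constructor
  · have h1 : ∃ x, 0 < q x := by
      by_contra hcon
      push Not at hcon
      have hanti : Antitone f := antitone_of_deriv_nonpos hdiff (fun x => by rw [hderiv]; exact hcon x)
      have h1 : f x0 ≤ 0 := ge_of_tendsto hf0 (by
        filter_upwards [eventually_le_atBot x0] with y hy using hanti hy)
      have h2 : 0 ≤ f x0 := by
        have := hanti (le_max_left x0 M)
        rwa [hfM _ (le_max_right x0 M)] at this
      exact hx0 (le_antisymm h1 h2)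
    obtain ⟨b, hb⟩ := h1
    have h2 : ∀ᶠ x in atBot, q x < q b / 2 := hq0.eventually_lt_const (by linarith)
    obtain ⟨a, ha, hab⟩ := (h2.and (eventually_lt_atBot b)).exists
    obtain ⟨x, hx, hx'⟩ := aux_mvt hq hab ha.le (by linarith : q b / 2 < q b)
    exact ⟨x, by linarith, hx'⟩
  · have h1 : ∃ x, q x < 0 := by
      by_contra hcon
      push Not at hcon
      have hmono : Monotone f := monotone_of_deriv_nonneg hdiff (fun x => by rw [hderiv]; exact hcon x)
      have h1 : 0 ≤ f x0 := le_of_tendsto hf0 (by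
        filter_upwards [eventually_le_atBot x0] with y hy using hmono hy)
      have h2 : f x0 ≤ 0 := by
        have := hmono (le_max_left x0 M)
        rwa [hfM _ (le_max_right x0 M)] at this
      exact hx0 (le_antisymm h2 h1)
    obtain ⟨b, hb⟩ := h1
    have hQ : ∀ x, HasDerivAt (fun x => -q (-x)) (q' (-x)) x := by
      intro x
      have := ((hq (-x)).comp x (hasDerivAt_neg x)).neg
      have e : -(q' (-x) * -1) = q' (-x) := by ring
      rw [e] at this
      exact this
    have hbM : b < max M b + 1 := by linarith [le_max_right M b]
    have hk := hqM (max M b + 1) (by linarith [le_max_left M b])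
    obtain ⟨x, hx, hx'⟩ := aux_mvt hQ (a := -(max M b + 1)) (b := -b) (k := 0)
      (by linarith) (by simp [-neg_add_rev, hk]) (by simp; linarith)
    exact ⟨-x, by simpa using hx, hx'⟩

open scoped FourierTransform RealInnerProductSpace in
lemma aux_radon_inj {M : ℝ} {φ : ℝ × ℝ → ℝ} (hc : Continuous φ) (hs : SuppIn M φ)
    (hr : ∀ s θ, radon φ s θ = 0) : φ = 0 := by
  set f : ℂ → ℂ := fun z => (φ (z.re, z.im) : ℂ) with hfdef
  have hfc : Continuous f := by fun_prop
  have hfz : ∀ z, z ∉ Metric.closedBall (0:ℂ) |M| → f z = 0 := by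
    intro z hz
    have hz1 : |M| < ‖z‖ := by simpa using hz
    have : M ^ 2 < z.re ^ 2 + z.im ^ 2 := by
      have h1 : |M| ^ 2 < ‖z‖ ^ 2 := by gcongr
      rw [sq_abs, Complex.sq_norm, Complex.normSq_apply] at h1
      nlinarith
    simp [hfdef, hs (z.re, z.im) this]
  have hfs : HasCompactSupport f :=
    HasCompactSupport.intro (isCompact_closedBall (0:ℂ) |M|) hfz
  have hfi : Integrable f := hfc.integrable_of_hasCompactSupport hfs
  have hF : 𝓕 f = 0 := by
    funext w
    rw [Real.fourier_eq']
    set g : ℂ → ℂ := fun v => Complex.exp ((↑(-2 * Real.pi * ⟪v, w⟫) * Complex.I)) • f v with hg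
    have hgi : Integrable g := by
      have hgc : Continuous g := by
        have h1 : Continuous (fun v : ℂ => ⟪v, w⟫) := continuous_id.inner continuous_const
        have h2 : Continuous (fun v : ℂ => Complex.exp ((↑(-2 * Real.pi * ⟪v, w⟫) * Complex.I))) :=
          Complex.continuous_exp.comp
            ((Complex.continuous_ofReal.comp (continuous_const.mul h1)).mul continuous_const)
        exact h2.mul hfc
      refine hgc.integrable_of_hasCompactSupport ?_
      refine HasCompactSupport.intro (isCompact_closedBall (0:ℂ) |M|) fun z hz => ?_
      simp only [hg]
      rw [hfz z hz, smul_zero]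
    set T := rotation (Circle.exp w.arg)
    have hT := T.measurePreserving
    have hP := Complex.volume_preserving_equiv_real_prod.symm
    have e1 : ∫ v, g v = ∫ p : ℝ × ℝ, g (T (Complex.measurableEquivRealProd.symm p)) := by
      rw [hP.integral_comp Complex.measurableEquivRealProd.symm.measurableEmbedding (fun z => g (T z)),
        hT.integral_comp T.toHomeomorph.measurableEmbedding]
    have hgi2 : Integrable (fun p : ℝ × ℝ => g (T (Complex.measurableEquivRealProd.symm p))) := by
      have h1 := (hT.integrable_comp_emb T.toHomeomorph.measurableEmbedding (g := g)).mpr hgi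
      exact (hP.integrable_comp_emb Complex.measurableEquivRealProd.symm.measurableEmbedding).mpr h1
    rw [e1, Measure.volume_eq_prod, integral_prod _ hgi2]
    have hTv : ∀ s t : ℝ, T (Complex.measurableEquivRealProd.symm (s, t))
        = ⟨s * Real.cos w.arg - t * Real.sin w.arg, s * Real.sin w.arg + t * Real.cos w.arg⟩ := by
      intro s t
      rw [rotation_apply, Circle.coe_exp, Complex.exp_mul_I, ← Complex.ofReal_cos, ← Complex.ofReal_sin]
      apply Complex.ext <;> simp [-Complex.ofReal_cos, -Complex.ofReal_sin] <;> ring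
    have e2 : ∀ s : ℝ, ∫ t : ℝ, g (T (Complex.measurableEquivRealProd.symm (s, t))) = 0 := by
      intro s
      have e3 : ∀ t : ℝ, g (T (Complex.measurableEquivRealProd.symm (s, t)))
          = Complex.exp ((↑(-2 * Real.pi * (s * ‖w‖)) * Complex.I)) *
            ((φ (s * Real.cos w.arg - t * Real.sin w.arg,
              s * Real.sin w.arg + t * Real.cos w.arg) : ℝ) : ℂ) := by
        intro t
        rw [hTv]
        have hre := Complex.norm_mul_cos_arg w
        have him := Complex.norm_mul_sin_arg w
        have hin : ⟪(⟨s * Real.cos w.arg - t * Real.sin w.arg,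
            s * Real.sin w.arg + t * Real.cos w.arg⟩ : ℂ), w⟫ = s * ‖w‖ := by
          rw [Complex.inner]
          simp only [Complex.mul_re, Complex.conj_re, Complex.conj_im]
          rw [← hre, ← him]
          have := Real.sin_sq_add_cos_sq w.arg
          linear_combination s * ‖w‖ * this
        simp only [hg, hin, smul_eq_mul, hfdef]
      simp only [e3]
      rw [integral_const_mul, integral_complex_ofReal]
      have := hr s w.arg
      unfold radon at this
      rw [this]
      simp
    simp only [e2, integral_zero, Pi.zero_apply]
  have hinv := hfc.fourierInv_fourier_eq hfi (by rw [hF]; exact integrable_zero _ _ _)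
  rw [hF] at hinv
  funext x
  have h1 := congrFun hinv ⟨x.1, x.2⟩
  rw [Real.fourierInv_eq] at h1
  simp [hfdef] at h1
  simpa using h1.symm

/-- The integrand `R φ₁ - ∂_s R φ₀` as an integral in `t`. -/
noncomputable def auxK (φ0 φ1 : ℝ × ℝ → ℝ) : ℝ × ℝ × ℝ → ℝ :=
  fun p => auxRot φ1 p - auxDS (auxRot φ0) p

lemma auxNice_K {M : ℝ} {φ0 φ1 : ℝ × ℝ → ℝ}
    (hφ0 : ContDiff ℝ (⊤ : ℕ∞) φ0) (hφ1 : ContDiff ℝ (⊤ : ℕ∞) φ1)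
    (hs0 : SuppIn M φ0) (hs1 : SuppIn M φ1) : AuxNice M (auxK φ0 φ1) :=
  auxNice_sub (auxNice_rot hφ1 hs1) (auxNice_dS (auxNice_rot hφ0 hs0))

lemma auxK_eq {M : ℝ} (hM : 0 < M) {φ0 φ1 : ℝ × ℝ → ℝ}
    (hφ0 : ContDiff ℝ (⊤ : ℕ∞) φ0) (hφ1 : ContDiff ℝ (⊤ : ℕ∞) φ1)
    (hs0 : SuppIn M φ0) (hs1 : SuppIn M φ1) (s θ : ℝ) :
    radon φ1 s θ - deriv (fun s' => radon φ0 s' θ) s = auxI (auxK φ0 φ1) s θ := by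
  have h0 := auxNice_rot hφ0 hs0
  unfold auxK
  rw [auxI_sub hM (auxNice_rot hφ1 hs1) (auxNice_dS h0), (auxI_hasDeriv hM h0 θ s).deriv.symm]
  rfl

/-- The constant in front of the half integral. -/
noncomputable def auxc : ℝ := 1 / (2 * Real.pi * Real.sqrt 2)

lemma auxc_pos : 0 < auxc := by unfold auxc; positivity

lemma aux_F0 {M : ℝ} (hM : 0 < M) {φ0 φ1 : ℝ × ℝ → ℝ}
    (hφ0 : ContDiff ℝ (⊤ : ℕ∞) φ0) (hφ1 : ContDiff ℝ (⊤ : ℕ∞) φ1)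
    (hs0 : SuppIn M φ0) (hs1 : SuppIn M φ1) (σ θ : ℝ) :
    F0 φ0 φ1 σ θ = auxc * auxJ (fun s => auxI (auxK φ0 φ1) s θ) σ := by
  unfold F0
  simp only [auxK_eq hM hφ0 hφ1 hs0 hs1]
  rw [auxJ_eq (fun s => auxI (auxK φ0 φ1) s θ)]
  rfl

lemma auxcJ_deriv {M : ℝ} (hM : 0 < M) {G : ℝ × ℝ × ℝ → ℝ} (hG : AuxNice M G) (σ θ : ℝ) :
    HasDerivAt (fun σ => auxc * auxJ (fun s => auxI G s θ) σ)
      (auxc * auxJ (fun s => auxI (auxDS G) s θ) σ) σ := by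
  have hG' := auxNice_dS hG
  refine HasDerivAt.const_mul auxc ?_
  refine auxJ_hasDeriv (M := M) ?_ (fun s => auxI_hasDeriv hM hG θ s)
    (fun s hs => auxI_supp hM hG θ hs) (fun s hs => auxI_supp hM hG' θ hs) σ
  exact (auxI_cont hM hG').comp (by fun_prop : Continuous fun s : ℝ => (s, θ))

lemma auxcJ_zero {M : ℝ} (hM : 0 < M) {G : ℝ × ℝ × ℝ → ℝ} (hG : AuxNice M G) {σ : ℝ} (θ : ℝ)
    (hσ : M ≤ σ) : auxc * auxJ (fun s => auxI G s θ) σ = 0 := by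
  have hcont : Continuous (fun s => auxI G s θ) :=
    (auxI_cont hM hG).comp (by fun_prop : Continuous fun s : ℝ => (s, θ))
  have hz : ∀ s, M ≤ s → auxI G s θ = 0 := by
    have hcl : IsClosed {s | auxI G s θ = 0} := isClosed_eq hcont continuous_const
    have hsub : Set.Ioi M ⊆ {s | auxI G s θ = 0} := fun s hs =>
      auxI_supp hM hG θ (lt_of_lt_of_le hs (le_abs_self s))
    have := hcl.closure_subset_iff.mpr hsub
    rw [closure_Ioi] at this
    exact fun s hs => this hs
  have : auxJ (fun s => auxI G s θ) σ = 0 := by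
    unfold auxJ
    have h1 : ∀ x : ℝ, auxI G (σ + x ^ 2) θ = 0 := fun x => hz _ (by nlinarith [sq_nonneg x])
    simp [h1]
  rw [this, mul_zero]

lemma aux_sqrt_le {M : ℝ} (hM : 0 < M) (σ : ℝ) :
    Real.sqrt (M - σ) - Real.sqrt (-M - σ) ≤ Real.sqrt (2 * M) := by
  by_cases h : 0 ≤ -M - σ
  · have h1 : Real.sqrt (M - σ) ≤ Real.sqrt (2 * M) + Real.sqrt (-M - σ) := by
      rw [Real.sqrt_le_left (by positivity)]
      nlinarith [Real.sq_sqrt h, Real.sq_sqrt (by linarith : 0 ≤ 2 * M),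
        mul_nonneg (Real.sqrt_nonneg (2 * M)) (Real.sqrt_nonneg (-M - σ))]
    linarith
  · rw [Real.sqrt_eq_zero_of_nonpos (by linarith : -M - σ ≤ 0), sub_zero]
    exact Real.sqrt_le_sqrt (by linarith)

lemma auxcJ_bound {M : ℝ} (hM : 0 < M) {G : ℝ × ℝ × ℝ → ℝ} (hG : AuxNice M G) :
    ∃ C, 0 ≤ C ∧ ∀ σ θ, θ ∈ Set.Icc 0 (2 * Real.pi) →
      |auxc * auxJ (fun s => auxI G s θ) σ| ≤ C := by
  obtain ⟨C, hC, hb⟩ := auxI_bound hM hG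
  have hc := auxc_pos
  refine ⟨auxc * (C * (2 * Real.sqrt (2 * M))), by positivity, fun σ θ hθ => ?_⟩
  rw [abs_mul, abs_of_pos hc]
  have := auxJ_bound hM.le hC (fun s => hb s θ hθ) (fun s hs => auxI_supp hM hG θ hs) σ
  gcongr
  refine this.trans ?_
  gcongr
  exact aux_sqrt_le hM σ

lemma auxcJ_tendsto {M : ℝ} (hM : 0 < M) {G : ℝ × ℝ × ℝ → ℝ} (hG : AuxNice M G) {θ : ℝ}
    (hθ : θ ∈ Set.Icc 0 (2 * Real.pi)) :
    Tendsto (fun σ => auxc * auxJ (fun s => auxI G s θ) σ) atBot (𝓝 0) := by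
  obtain ⟨C, hC, hb⟩ := auxI_bound hM hG
  have h1 : Tendsto (fun σ : ℝ => Real.sqrt (M - σ)) atBot atTop := by
    refine Real.tendsto_sqrt_atTop.comp ?_
    exact tendsto_atTop_add_const_left _ M tendsto_neg_atBot_atTop
  have h2 : Tendsto (fun σ : ℝ => C * (2 * ((2 * M) / Real.sqrt (M - σ)))) atBot (𝓝 0) := by
    have := ((h1.const_div_atTop (2 * M)).const_mul 2).const_mul C
    simpa using this
  have h3 : Tendsto (auxJ (fun s => auxI G s θ)) atBot (𝓝 0) := by
    refine squeeze_zero_norm' ?_ h2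
    filter_upwards [eventually_lt_atBot (-M)] with σ hσ
    have := auxJ_bound hM.le hC (fun s => hb s θ hθ) (fun s hs => auxI_supp hM hG θ hs) σ
    refine this.trans ?_
    have hp : 0 < Real.sqrt (M - σ) := Real.sqrt_pos.mpr (by linarith)
    have hle : Real.sqrt (-M - σ) ≤ Real.sqrt (M - σ) := Real.sqrt_le_sqrt (by linarith)
    gcongr
    rw [le_div_iff₀ hp]
    nlinarith [Real.sq_sqrt (by linarith : 0 ≤ M - σ), Real.sq_sqrt (by linarith : 0 ≤ -M - σ),
      mul_le_mul_of_nonneg_left hle (Real.sqrt_nonneg (-M - σ))]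
  simpa using h3.const_mul auxc

/-- The quadratic symbol. -/
noncomputable def auxD (d : Fin 3 → Fin 3 → ℝ) (θ : ℝ) : ℝ :=
  ∑ i : Fin 3, ∑ j : Fin 3, d i j * omegaHat θ i * omegaHat θ j

/-- The cubic symbol. -/
noncomputable def auxE (e : Fin 3 → Fin 3 → Fin 3 → ℝ) (θ : ℝ) : ℝ :=
  ∑ i : Fin 3, ∑ j : Fin 3, ∑ k : Fin 3,
      e i j k * omegaHat θ i * omegaHat θ j * omegaHat θ k

lemma aux_omega_an (i : Fin 3) : AnalyticOnNhd ℝ (fun θ => omegaHat θ i) Set.univ := by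
  intro θ _
  fin_cases i
  · exact analyticAt_const
  · exact Real.analyticAt_cos
  · exact Real.analyticAt_sin

lemma auxD_an (d : Fin 3 → Fin 3 → ℝ) : AnalyticOnNhd ℝ (auxD d) Set.univ := by
  intro θ h
  have := fun i => aux_omega_an i θ h
  unfold auxD
  simp only [Fin.sum_univ_three]
  fun_prop (disch := assumption)

lemma auxE_an (e : Fin 3 → Fin 3 → Fin 3 → ℝ) : AnalyticOnNhd ℝ (auxE e) Set.univ := by
  intro θ h
  have := fun i => aux_omega_an i θ h
  unfold auxE
  simp only [Fin.sum_univ_three]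
  fun_prop (disch := assumption)

lemma auxD_ne (d : Fin 3 → Fin 3 → ℝ)
    (hdsymm : ∀ i j, d i j = d j i) (hd00 : d 0 0 = 0)
    (hdne : ∃ i j : Fin 3, (i, j) ≠ ((0 : Fin 3), (0 : Fin 3)) ∧ d i j ≠ 0) :
    ∃ θ, auxD d θ ≠ 0 := by
  by_contra hcon
  push Not at hcon
  have h10 := hdsymm 1 0
  have h20 := hdsymm 2 0
  have h21 := hdsymm 2 1
  have a1 := hcon 0
  have a2 := hcon Real.pi
  have a3 := hcon (Real.pi / 2)
  have a4 := hcon (-(Real.pi / 2))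
  have a5 := hcon (Real.pi / 4)
  simp [auxD, Fin.sum_univ_three, omegaHat, h10, h20, h21, hd00] at a1 a2 a3 a4 a5
  have b01 : d 0 1 = 0 := by linarith
  have b11 : d 1 1 = 0 := by linarith
  have b02 : d 0 2 = 0 := by linarith
  have b22 : d 2 2 = 0 := by linarith
  have b12 : d 1 2 = 0 := by
    simpa [b01, b11, b02, b22] using a5
  obtain ⟨i, j, -, hij⟩ := hdne
  apply hij
  have b10 : d 1 0 = 0 := h10.trans b01
  have b20 : d 2 0 = 0 := h20.trans b02
  have b21 : d 2 1 = 0 := h21.trans b12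
  fin_cases i <;> fin_cases j <;> assumption

lemma auxE_ne (e : Fin 3 → Fin 3 → Fin 3 → ℝ) (h : NullCondFails e) : ∃ θ, auxE e θ ≠ 0 := by
  obtain ⟨ξ, hξ, hne, hsum⟩ := h
  have h0 : ξ 0 ≠ 0 := by
    intro h0
    rw [h0] at hξ
    rcases hne with h | h
    · have := sq_pos_of_ne_zero h
      nlinarith [sq_nonneg (ξ 2)]
    · have := sq_pos_of_ne_zero h
      nlinarith [sq_nonneg (ξ 1)]
  set z : ℂ := ⟨-ξ 1 / ξ 0, -ξ 2 / ξ 0⟩ with hz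
  have hnorm : ‖z‖ = 1 := by
    rw [← sq_eq_sq₀ (norm_nonneg _) zero_le_one, Complex.sq_norm, Complex.normSq_apply, hz]
    field_simp
    linarith
  have hc := Complex.norm_mul_cos_arg z
  have hs := Complex.norm_mul_sin_arg z
  rw [hnorm, one_mul] at hc hs
  refine ⟨z.arg, fun hE => hsum ?_⟩
  have hom : ∀ i, ξ i = (-ξ 0) * omegaHat z.arg i := by
    intro i
    fin_cases i
    · simp [omegaHat]
    · change ξ 1 = -ξ 0 * Real.cos z.arg
      rw [hc]
      change ξ 1 = -ξ 0 * (-ξ 1 / ξ 0)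
      field_simp
    · change ξ 2 = -ξ 0 * Real.sin z.arg
      rw [hs]
      change ξ 2 = -ξ 0 * (-ξ 2 / ξ 0)
      field_simp
  have : ∑ i : Fin 3, ∑ j : Fin 3, ∑ k : Fin 3, e i j k * ξ i * ξ j * ξ k
      = (-ξ 0) ^ 3 * auxE e z.arg := by
    unfold auxE
    simp only [Finset.mul_sum]
    refine Finset.sum_congr rfl fun i _ => Finset.sum_congr rfl fun j _ =>
      Finset.sum_congr rfl fun k _ => ?_
    rw [hom i, hom j, hom k]
    ring
  rw [this, hE, mul_zero]

lemma aux_radon_neg (φ : ℝ × ℝ → ℝ) (s θ : ℝ) : radon φ s (θ + Real.pi) = radon φ (-s) θ := by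
  unfold radon
  rw [← integral_neg_eq_self]
  congr 1
  funext t
  rw [Real.cos_add_pi, Real.sin_add_pi]
  congr 2 <;> ring

/-- Vanishing of `R φ₁ - ∂_s R φ₀` forces the data to vanish. -/
lemma aux_data_zero {M : ℝ} (hM : 0 < M) {φ0 φ1 : ℝ × ℝ → ℝ}
    (hφ0 : ContDiff ℝ (⊤ : ℕ∞) φ0) (hφ1 : ContDiff ℝ (⊤ : ℕ∞) φ1)
    (hs0 : SuppIn M φ0) (hs1 : SuppIn M φ1)
    (h : ∀ s θ, radon φ1 s θ - deriv (fun s' => radon φ0 s' θ) s = 0) : φ0 = 0 ∧ φ1 = 0 := by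
  have key : ∀ s θ, radon φ1 s θ + deriv (fun s' => radon φ0 s' θ) s = 0 := by
    intro s θ
    have h1 := h (-s) (θ + Real.pi)
    simp only [aux_radon_neg] at h1
    rw [deriv_comp_neg (fun s' => radon φ0 s' θ), neg_neg] at h1
    linarith
  have hr1 : ∀ s θ, radon φ1 s θ = 0 := fun s θ => by linarith [h s θ, key s θ]
  have hr0 : ∀ s θ, radon φ0 s θ = 0 := by
    intro s θ
    have hn := auxNice_rot hφ0 hs0
    have hdiff : Differentiable ℝ (fun s' => radon φ0 s' θ) :=
      fun s => (auxI_hasDeriv hM hn θ s).differentiableAt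
    have hconst := is_const_of_deriv_eq_zero hdiff (fun s => by linarith [h s θ, key s θ]) s (M + 1)
    rw [hconst]
    exact auxI_supp hM hn θ (by rw [abs_of_pos (by linarith)]; linarith)
  exact ⟨aux_radon_inj hφ0.continuous hs0 hr0, aux_radon_inj hφ1.continuous hs1 hr1⟩

lemma aux_exists_theta {M : ℝ} (hM : 0 < M) {φ0 φ1 : ℝ × ℝ → ℝ}
    (hφ0 : ContDiff ℝ (⊤ : ℕ∞) φ0) (hφ1 : ContDiff ℝ (⊤ : ℕ∞) φ1)
    (hs0 : SuppIn M φ0) (hs1 : SuppIn M φ1) (hne : φ0 ≠ 0 ∨ φ1 ≠ 0)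
    {d : Fin 3 → Fin 3 → ℝ} {e : Fin 3 → Fin 3 → Fin 3 → ℝ}
    (hD : ∃ θ, auxD d θ ≠ 0) (hE : ∃ θ, auxE e θ ≠ 0) :
    ∃ θ ∈ Set.Icc 0 (2 * Real.pi), auxD d θ ≠ 0 ∧ auxE e θ ≠ 0 ∧ ∃ σ, F0 φ0 φ1 σ θ ≠ 0 := by
  have hK := auxNice_K hφ0 hφ1 hs0 hs1
  have hK' := auxNice_dS hK
  by_contra hcon
  push Not at hcon
  set W : ℝ → ℝ := fun θ => auxD d θ * auxE e θ with hW
  have hWan : AnalyticOnNhd ℝ W Set.univ := (auxD_an d).mul (auxE_an e)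
  have hWne : ¬ Set.EqOn W 0 Set.univ := by
    intro h0
    rcases AnalyticOnNhd.eq_zero_or_eq_zero_of_mul_eq_zero (auxD_an d) (auxE_an e)
      (fun θ hθ => h0 hθ) isPreconnected_univ with h | h
    · exact hD.choose_spec (h _ trivial)
    · exact hE.choose_spec (h _ trivial)
  have step1 : ∀ θ, W θ ≠ 0 → ∀ s, auxI (auxK φ0 φ1) s θ = 0 := by
    intro θ hθ s
    set θ' := toIcoMod Real.two_pi_pos 0 θ with hθ'
    have hmem : θ' ∈ Set.Ico 0 (0 + 2 * Real.pi) := toIcoMod_mem_Ico _ _ _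
    have heq : θ' = θ - toIcoDiv Real.two_pi_pos 0 θ * (2 * Real.pi) := by
      rw [hθ', toIcoMod]; simp
    have hcos : Real.cos θ' = Real.cos θ := by rw [heq, Real.cos_sub_int_mul_two_pi]
    have hsin : Real.sin θ' = Real.sin θ := by rw [heq, Real.sin_sub_int_mul_two_pi]
    have hom : omegaHat θ' = omegaHat θ := by simp [omegaHat, hcos, hsin]
    have hDD : auxD d θ' = auxD d θ := by simp [auxD, hom]
    have hEE : auxE e θ' = auxE e θ := by simp [auxE, hom]
    have hrad : ∀ φ s, radon φ s θ' = radon φ s θ := by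
      intro φ s
      simp [radon, hcos, hsin]
    have hF := hcon θ' ⟨hmem.1, by linarith [hmem.2]⟩
      (by rw [hDD]; exact left_ne_zero_of_mul hθ) (by rw [hEE]; exact right_ne_zero_of_mul hθ)
    have hJ : ∀ σ, auxJ (fun s => auxI (auxK φ0 φ1) s θ') σ = 0 := by
      intro σ
      have := hF σ
      rw [aux_F0 hM hφ0 hφ1 hs0 hs1] at this
      exact (mul_eq_zero.mp this).resolve_left auxc_pos.ne'
    have hz := auxJ_inj (M := M) (h' := fun s => auxI (auxDS (auxK φ0 φ1)) s θ')
      ((auxI_cont hM hK').comp (by fun_prop : Continuous fun s : ℝ => (s, θ')))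
      (fun s => auxI_hasDeriv hM hK θ' s) (fun s hs => auxI_supp hM hK θ' hs)
      (fun s hs => auxI_supp hM hK' θ' hs) hJ s
    rw [← auxK_eq hM hφ0 hφ1 hs0 hs1] at hz ⊢
    simpa only [hrad] using hz
  have step2 : ∀ s θ, auxI (auxK φ0 φ1) s θ = 0 := by
    intro s θ
    have hev : ∀ᶠ x in 𝓝[≠] θ, W x ≠ 0 := by
      by_contra hh
      exact hWne (hWan.eqOn_zero_of_preconnected_of_frequently_eq_zero isPreconnected_univ
        (Set.mem_univ θ) ((Filter.not_eventually.mp hh).mono fun x hx => not_not.mp hx))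
    have hcont : Continuous (fun θ => auxI (auxK φ0 φ1) s θ) :=
      (auxI_cont hM hK).comp (by fun_prop : Continuous fun θ : ℝ => (s, θ))
    have ht : Tendsto (fun θ => auxI (auxK φ0 φ1) s θ) (𝓝[≠] θ) (𝓝 (auxI (auxK φ0 φ1) s θ)) :=
      hcont.continuousAt.tendsto.mono_left nhdsWithin_le_nhds
    refine tendsto_nhds_unique ht (tendsto_const_nhds.congr' ?_)
    filter_upwards [hev] with x hx using (step1 x hx s).symm
  have := aux_data_zero hM hφ0 hφ1 hs0 hs1
    (fun s θ => by rw [auxK_eq hM hφ0 hφ1 hs0 hs1]; exact step2 s θ)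
  rcases hne with h | h
  · exact h this.1
  · exact h this.2

/-- Elementary positivity. -/
lemma aux_G_pos {a b : ℝ} (ha : a ≠ 0) (hb : 0 < b) (hab : 0 < 1 + a / b) :
    0 < 1 / a * Real.log (1 + a / b) := by
  rcases lt_or_gt_of_ne ha with h | h
  · have h1 : a / b < 0 := div_neg_of_neg_of_pos h hb
    exact mul_pos_of_neg_of_neg (one_div_neg.mpr h) (Real.log_neg hab (by linarith))
  · have h1 : 0 < a / b := div_pos h hb
    exact mul_pos (one_div_pos.mpr h) (Real.log_pos (by linarith))

/-- Elementary lower bound. -/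
lemma aux_G_lower {a b C : ℝ} (haC : |a| ≤ C) (hbC : |b| ≤ C) (ha : a ≠ 0) (hb : b ≠ 0)
    (hab : 0 < 1 + a / b) (hG : 0 < 1 / a * Real.log (1 + a / b)) :
    1 / (2 * C) ≤ 1 / a * Real.log (1 + a / b) := by
  have hC : 0 < C := lt_of_lt_of_le (abs_pos.mpr ha) haC
  have hb' : 0 < b := by
    rcases lt_or_gt_of_ne hb with hb0 | hb0
    swap
    · exact hb0
    exfalso
    rcases lt_or_gt_of_ne ha with h | h
    · have h1 : 0 < a / b := div_pos_of_neg_of_neg h hb0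
      have := mul_neg_of_neg_of_pos (one_div_neg.mpr h) (Real.log_pos (by linarith : 1 < 1 + a / b))
      linarith
    · have h1 : a / b < 0 := div_neg_of_pos_of_neg h hb0
      have := mul_neg_of_pos_of_neg (one_div_pos.mpr h) (Real.log_neg hab (by linarith))
      linarith
  have hbC' : b ≤ C := (le_abs_self b).trans hbC
  have haC' : a ≤ C := (le_abs_self a).trans haC
  rcases lt_or_gt_of_ne ha with h | h
  · have h1 : Real.log (1 + a / b) ≤ a / b := by linarith [Real.log_le_sub_one_of_pos hab]
    have h2 : 1 / a * (a / b) ≤ 1 / a * Real.log (1 + a / b) :=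
      mul_le_mul_of_nonpos_left h1 (one_div_neg.mpr h).le
    have h3 : 1 / a * (a / b) = 1 / b := by field_simp
    rw [h3] at h2
    refine le_trans ?_ h2
    apply one_div_le_one_div_of_le hb'
    linarith
  · have h1 := Real.one_sub_inv_le_log_of_pos hab
    have h2 : 1 / a * (1 - (1 + a / b)⁻¹) ≤ 1 / a * Real.log (1 + a / b) :=
      mul_le_mul_of_nonneg_left h1 (one_div_pos.mpr h).le
    have hs : 0 < b + a := by linarith
    have h3 : 1 / a * (1 - (1 + a / b)⁻¹) = 1 / (b + a) := by
      have : 1 + a / b = (b + a) / b := by field_simp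
      rw [this, inv_div]
      field_simp
      ring
    rw [h3] at h2
    refine le_trans ?_ h2
    apply one_div_le_one_div_of_le hs
    linarith

/-- Lemma 2.1: if `(φ₀,φ₁) ≢ 0` then `0 < τ₀ < ∞`; in particular `B ≠ ∅`. -/
theorem tau0_pos_and_finite
    (M : ℝ) (hM : 0 < M)
    (φ0 φ1 : ℝ × ℝ → ℝ)
    (hφ0 : ContDiff ℝ (⊤ : ℕ∞) φ0) (hφ1 : ContDiff ℝ (⊤ : ℕ∞) φ1)
    (hs0 : SuppIn M φ0) (hs1 : SuppIn M φ1)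
    (d : Fin 3 → Fin 3 → ℝ)
    (hdsymm : ∀ i j, d i j = d j i) (hd00 : d 0 0 = 0)
    (hdne : ∃ i j : Fin 3, (i, j) ≠ ((0 : Fin 3), (0 : Fin 3)) ∧ d i j ≠ 0)
    (e : Fin 3 → Fin 3 → Fin 3 → ℝ)
    (hnull : NullCondFails e)
    (hne : φ0 ≠ 0 ∨ φ1 ≠ 0) :
    (setB M d e φ0 φ1).Nonempty ∧ 0 < tau0 M d e φ0 φ1 := by
  have hK := auxNice_K hφ0 hφ1 hs0 hs1
  have hK1 := auxNice_dS hK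
  have hK2 := auxNice_dS hK1
  set G := auxK φ0 φ1 with hGdef
  have hF0 : ∀ θ, (fun σ => F0 φ0 φ1 σ θ) = fun σ => auxc * auxJ (fun s => auxI G s θ) σ :=
    fun θ => funext fun σ => aux_F0 hM hφ0 hφ1 hs0 hs1 σ θ
  have hd1 : ∀ θ, deriv (fun σ => F0 φ0 φ1 σ θ)
      = fun σ => auxc * auxJ (fun s => auxI (auxDS G) s θ) σ := by
    intro θ
    rw [hF0]
    exact funext fun σ => (auxcJ_deriv hM hK σ θ).deriv
  have hd2 : ∀ θ σ, deriv (fun σ' => deriv (fun σ'' => F0 φ0 φ1 σ'' θ) σ') σ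
      = auxc * auxJ (fun s => auxI (auxDS (auxDS G)) s θ) σ := by
    intro θ σ
    rw [show (fun σ' => deriv (fun σ'' => F0 φ0 φ1 σ'' θ) σ')
      = deriv (fun σ'' => F0 φ0 φ1 σ'' θ) from rfl, hd1]
    exact (auxcJ_deriv hM hK1 σ θ).deriv
  have hF1 : ∀ σ θ, F1 d φ0 φ1 σ θ
      = auxD d θ * (auxc * auxJ (fun s => auxI (auxDS G) s θ) σ) := by
    intro σ θ
    unfold F1
    rw [hd1]
    rfl
  have hF2 : ∀ σ θ, F2 e φ0 φ1 σ θ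
      = auxE e θ * (auxc * auxJ (fun s => auxI (auxDS (auxDS G)) s θ) σ) := by
    intro σ θ
    unfold F2
    rw [hd2]
    rfl
  have hnonempty : (setB M d e φ0 φ1).Nonempty := by
    obtain ⟨θ, hθ, hD, hE, σ0, hσ0⟩ := aux_exists_theta hM hφ0 hφ1 hs0 hs1 hne
      (auxD_ne d hdsymm hd00 hdne) (auxE_ne e hnull)
    have hsign := aux_sign (M := M)
      (f := fun σ => auxE e θ * (auxc * auxJ (fun s => auxI G s θ) σ))
      (q := fun σ => auxE e θ * (auxc * auxJ (fun s => auxI (auxDS G) s θ) σ))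
      (q' := fun σ => auxE e θ * (auxc * auxJ (fun s => auxI (auxDS (auxDS G)) s θ) σ))
      (fun σ => (auxcJ_deriv hM hK σ θ).const_mul _)
      (fun σ => (auxcJ_deriv hM hK1 σ θ).const_mul _)
      (by simpa using (auxcJ_tendsto hM hK hθ).const_mul (auxE e θ))
      (by simpa using (auxcJ_tendsto hM hK1 hθ).const_mul (auxE e θ))
      (fun σ hσ => by simp only [auxcJ_zero hM hK θ hσ, mul_zero])
      (fun σ hσ => by simp only [auxcJ_zero hM hK1 θ hσ, mul_zero])
      ⟨σ0, mul_ne_zero hE (by rw [← aux_F0 hM hφ0 hφ1 hs0 hs1]; exact hσ0)⟩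
    have hex : ∃ σ, 0 < F1 d φ0 φ1 σ θ ∧ 0 < F2 e φ0 φ1 σ θ := by
      simp only [hF1, hF2]
      have hmul : ∀ x : ℝ, auxD d θ * x = (auxD d θ / auxE e θ) * (auxE e θ * x) := by
        intro x
        field_simp
      rcases lt_or_gt_of_ne (div_ne_zero hD hE) with hr | hr
      · obtain ⟨σ, h1, h2⟩ := hsign.2
        refine ⟨σ, ?_, h2⟩
        rw [hmul]
        exact mul_pos_of_neg_of_neg hr h1
      · obtain ⟨σ, h1, h2⟩ := hsign.1
        refine ⟨σ, ?_, h2⟩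
        rw [hmul]
        exact mul_pos hr h1
    obtain ⟨σ, h1, h2⟩ := hex
    have h3 : 0 < 1 + F1 d φ0 φ1 σ θ / F2 e φ0 φ1 σ θ := by positivity
    refine ⟨(σ, θ), ⟨?_, hθ, h1.ne', h2.ne', h3⟩, aux_G_pos h1.ne' h2 h3⟩
    by_contra hh
    have hh : M ≤ σ := not_lt.mp hh
    rw [hF1, auxcJ_zero hM hK1 θ hh, mul_zero] at h1
    exact lt_irrefl _ h1
  refine ⟨hnonempty, ?_⟩
  obtain ⟨C1, hC1, hb1⟩ := auxcJ_bound hM hK1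
  obtain ⟨C2, hC2, hb2⟩ := auxcJ_bound hM hK2
  obtain ⟨CD, hCD⟩ := (isCompact_Icc (a := (0:ℝ)) (b := 2 * Real.pi)).exists_bound_of_continuousOn
    ((auxD_an d).continuousOn.mono (Set.subset_univ _))
  obtain ⟨CE, hCE⟩ := (isCompact_Icc (a := (0:ℝ)) (b := 2 * Real.pi)).exists_bound_of_continuousOn
    ((auxE_an e).continuousOn.mono (Set.subset_univ _))
  set C : ℝ := CD * C1 + CE * C2 + 1 with hC
  have h0mem : (0:ℝ) ∈ Set.Icc 0 (2 * Real.pi) := ⟨le_refl _, Real.two_pi_pos.le⟩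
  have hCD0 : 0 ≤ CD := (norm_nonneg _).trans (hCD 0 h0mem)
  have hCE0 : 0 ≤ CE := (norm_nonneg _).trans (hCE 0 h0mem)
  have hp1 : 0 ≤ CD * C1 := mul_nonneg hCD0 hC1
  have hp2 : 0 ≤ CE * C2 := mul_nonneg hCE0 hC2
  have hlow : 1 / (2 * C) ≤ tau0 M d e φ0 φ1 := by
    refine le_csInf (hnonempty.image _) ?_
    rintro _ ⟨⟨σ, θ⟩, ⟨⟨_, hθ, hA1, hA2, hA3⟩, hG⟩, rfl⟩
    refine aux_G_lower ?_ ?_ hA1 hA2 hA3 hG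
    · simp only [hF1, abs_mul (auxD d θ)]
      have := mul_le_mul (hCD θ hθ) (hb1 σ θ hθ) (abs_nonneg _) hCD0
      rw [Real.norm_eq_abs] at this
      linarith
    · simp only [hF2, abs_mul (auxE e θ)]
      have := mul_le_mul (hCE θ hθ) (hb2 σ θ hθ) (abs_nonneg _) hCE0
      rw [Real.norm_eq_abs] at this
      linarith
  refine lt_of_lt_of_le ?_ hlow
  have : 0 < C := by linarith
  positivity
end

section
/- If (φ₀,φ₁) ≢ 0, then the set D = {(σ,θ) ∈ (−∞,M)×[0,2π] : F₂(σ,θ) > 0} is nonempty. -/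
open Real MeasureTheory Filter Topology Asymptotics

/-! ### One-dimensional part: the Abel transform -/

/-- Abel transform. -/
noncomputable def abelT (g : ℝ → ℝ) (σ : ℝ) : ℝ :=
  ∫ s in Set.Ioi σ, g s / Real.sqrt (s - σ)

/-- The Abel kernel. -/
noncomputable def abelW : ℝ → ℝ :=
  Set.indicator (Set.Iio 0) (fun x => (-x) ^ (-(1/2) : ℝ))

lemma abelW_locInt : LocallyIntegrable abelW volume := by
  unfold abelW
  apply LocallyIntegrable.indicator _ measurableSet_Iio
  rw [locallyIntegrable_iff]
  intro K hK
  obtain ⟨R, hR⟩ := hK.isBounded.subset_closedBall 0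
  rw [Real.closedBall_eq_Icc] at hR
  refine IntegrableOn.mono_set ?_ hR
  have h : IntervalIntegrable (fun x : ℝ => x ^ (-(1/2) : ℝ)) volume (-(0-R)) (-(0 + R)) :=
    intervalIntegral.intervalIntegrable_rpow' (by norm_num)
  have h2 := (IntervalIntegrable.iff_comp_neg (f := fun x : ℝ => x ^ (-(1/2) : ℝ))).1 h
  simp only [neg_neg] at h2
  by_cases hR0 : 0 - R ≤ 0 + R
  · exact (intervalIntegrable_iff_integrableOn_Icc_of_le hR0).1 h2
  · rw [Set.Icc_eq_empty hR0]; exact integrableOn_empty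

open scoped Convolution in
lemma abelT_eq_conv (g : ℝ → ℝ) :
    abelT g = (g ⋆[ContinuousLinearMap.mul ℝ ℝ, volume] abelW) := by
  ext σ
  rw [convolution_def, abelT, ← integral_indicator measurableSet_Ioi]
  congr 1
  ext s
  simp only [ContinuousLinearMap.mul_apply', abelW, Set.indicator]
  by_cases h : σ < s
  · have h1 : σ - s < 0 := by linarith
    simp only [Set.mem_Ioi, h, Set.mem_Iio, h1, if_true]
    rw [neg_sub, Real.rpow_neg (by linarith), ← Real.sqrt_eq_rpow, div_eq_mul_inv]
  · have h1 : ¬ (σ - s < 0) := by linarith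
    simp [h, h1]

lemma abelT_hasDerivAt {g : ℝ → ℝ} (hc : HasCompactSupport g) (hg : ContDiff ℝ 1 g) (σ : ℝ) :
    HasDerivAt (abelT g) (abelT (deriv g) σ) σ := by
  rw [abelT_eq_conv, abelT_eq_conv]
  exact hc.hasDerivAt_convolution_left _ hg abelW_locInt σ

lemma abelT_zero_right {M : ℝ} {g : ℝ → ℝ} (hg : ∀ s, M < s → g s = 0) {σ : ℝ} (hσ : M ≤ σ) :
    abelT g σ = 0 := by
  unfold abelT
  apply setIntegral_eq_zero_of_forall_eq_zero
  intro s hs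
  rw [hg s (lt_of_le_of_lt hσ hs), zero_div]

lemma abelT_tendsto {M : ℝ} {g : ℝ → ℝ} (hc : Continuous g) (hg : ∀ s, M < |s| → g s = 0) :
    Tendsto (abelT g) atBot (𝓝 0) := by
  have hcs : HasCompactSupport g := by
    apply HasCompactSupport.intro (K := Set.Icc (-M) M) isCompact_Icc
    intro x hx
    apply hg
    by_contra h
    exact hx (abs_le.1 (not_lt.1 h))
  obtain ⟨C, hC⟩ := hcs.exists_bound_of_continuous hc
  have key : ∀ σ, σ < -M → ‖abelT g σ‖ ≤ (C / Real.sqrt (-M - σ)) * volume.real (Set.Icc (-M) M) := by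
    intro σ hσ
    have : abelT g σ = ∫ s in Set.Icc (-M) M, g s / Real.sqrt (s - σ) := by
      unfold abelT
      apply setIntegral_eq_of_subset_of_forall_sdiff_eq_zero measurableSet_Ioi
      · intro x hx; exact lt_of_lt_of_le hσ hx.1
      · intro x hx
        rw [hg x, zero_div]
        by_contra h
        exact hx.2 (abs_le.1 (not_lt.1 h))
    rw [this]
    apply norm_setIntegral_le_of_norm_le_const
    · exact isCompact_Icc.measure_lt_top
    · intro x hx
      have hC0 : 0 ≤ C := (norm_nonneg _).trans (hC 0)
      rw [norm_div, Real.norm_of_nonneg (Real.sqrt_nonneg _)]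
      have h0 : 0 < Real.sqrt (-M - σ) := Real.sqrt_pos.2 (by linarith)
      gcongr
      · exact hC x
      · exact hx.1
  rw [tendsto_zero_iff_norm_tendsto_zero]
  have lim : Tendsto (fun σ => (C / Real.sqrt (-M - σ)) * volume.real (Set.Icc (-M) M)) atBot (𝓝 0) := by
    rw [show (0:ℝ) = 0 * volume.real (Set.Icc (-M) M) by simp]
    apply Tendsto.mul_const
    apply Tendsto.const_div_atTop
    apply Real.tendsto_sqrt_atTop.comp
    exact tendsto_atTop_add_const_left _ _ tendsto_neg_atBot_atTop
  refine tendsto_of_tendsto_of_tendsto_of_le_of_le' tendsto_const_nhds lim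
    (Eventually.of_forall fun _ => norm_nonneg _) ?_
  filter_upwards [eventually_lt_atBot (-M)] with σ hσ using key σ hσ

lemma abelT_eq_sq (g : ℝ → ℝ) (σ : ℝ) : abelT g σ = ∫ x : ℝ, g (σ + x ^ 2) := by
  have h1 : abelT g σ = ∫ u in Set.Ioi (0:ℝ), g (σ + u) / Real.sqrt u := by
    unfold abelT
    have := (measurePreserving_add_left volume σ).setIntegral_preimage_emb
      (measurableEmbedding_addLeft σ) (fun s => g s / Real.sqrt (s - σ)) (Set.Ioi σ)
    simp only [add_sub_cancel_left, Set.preimage_const_add_Ioi, sub_self] at this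
    exact this.symm
  have h2 := integral_comp_rpow_Ioi_of_pos (g := fun u => g (σ + u) / Real.sqrt u)
    (p := 2) (by norm_num)
  have h3 := integral_comp_abs (f := fun x => g (σ + x ^ 2))
  simp only [sq_abs] at h3
  rw [h1, ← h2, h3, ← integral_const_mul]
  apply setIntegral_congr_fun measurableSet_Ioi
  intro x hx
  have hx : 0 < x := hx
  have e1 : x ^ (2:ℝ) = x ^ 2 := by norm_cast
  have e2 : x ^ ((2:ℝ) - 1) = x := by norm_num
  simp only [smul_eq_mul]
  rw [e1, e2, Real.sqrt_sq hx.le]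
  field_simp

/-- Injectivity of the Abel transform (on derivatives). -/
lemma abel_inj {g : ℝ → ℝ} (hc : HasCompactSupport g) (hg : ContDiff ℝ 1 g)
    (h : ∀ σ, abelT (deriv g) σ = 0) (τ : ℝ) : g τ = 0 := by
  have hd : Continuous (deriv g) := hg.continuous_deriv le_rfl
  have hdc : HasCompactSupport (deriv g) := hc.deriv
  have hdiff : Differentiable ℝ g := hg.differentiable one_ne_zero
  obtain ⟨R, hR⟩ := hdc.isCompact.isBounded.subset_closedBall 0
  have hz : ∀ s, R < |s| → deriv g s = 0 := by
    intro s hs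
    by_contra hne
    have := hR (subset_tsupport _ hne)
    rw [mem_closedBall_zero_iff, Real.norm_eq_abs] at this
    linarith
  -- double integral
  have hint : Integrable (fun p : ℝ × ℝ => deriv g (τ + p.1 ^ 2 + p.2 ^ 2)) := by
    apply Continuous.integrable_of_hasCompactSupport
    · fun_prop
    · apply HasCompactSupport.intro
        (K := Metric.closedBall (0 : ℝ × ℝ) (|R| + |τ| + 1)) (isCompact_closedBall _ _)
      intro p hp
      apply hz
      rw [mem_closedBall_zero_iff, Prod.norm_def, max_le_iff, not_and_or, Real.norm_eq_abs,
        Real.norm_eq_abs] at hp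
      have a1 := le_abs_self R
      have a2 := neg_abs_le τ
      have a3 := abs_nonneg R
      have a4 := abs_nonneg τ
      refine lt_of_lt_of_le ?_ (le_abs_self _)
      rcases hp with hp | hp
      · nlinarith [sq_abs p.1, sq_nonneg p.2]
      · nlinarith [sq_abs p.2, sq_nonneg p.1]
  have I0 : ∫ p : ℝ × ℝ, deriv g (τ + p.1 ^ 2 + p.2 ^ 2) = 0 := by
    rw [Measure.volume_eq_prod, integral_prod _ hint]
    simp only [← abelT_eq_sq, h, integral_zero]
  rw [← integral_comp_polarCoord_symm] at I0
  have e : ∀ p : ℝ × ℝ, p.1 • deriv g (τ + (polarCoord.symm p).1 ^ 2 + (polarCoord.symm p).2 ^ 2)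
      = (p.1 * deriv g (τ + p.1 ^ 2)) * (fun _ => (1:ℝ)) p.2 := by
    intro p
    simp only [polarCoord_symm_apply, smul_eq_mul, mul_one]
    congr 2
    nlinarith [Real.sin_sq_add_cos_sq p.2]
  simp only [e] at I0
  rw [polarCoord_target, Measure.volume_eq_prod] at I0
  rw [setIntegral_prod_mul (fun r => r * deriv g (τ + r ^ 2)) (fun _ => (1:ℝ))] at I0
  have hpi : (∫ _x in Set.Ioo (-π) π, (1:ℝ)) ≠ 0 := by
    simp [Real.pi_pos.le, Real.pi_ne_zero]
  have I1 : ∫ r in Set.Ioi (0:ℝ), r * deriv g (τ + r ^ 2) = 0 := by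
    rcases mul_eq_zero.1 I0 with h | h
    · exact h
    · exact absurd h hpi
  have hti : Tendsto (fun r : ℝ => τ + r ^ 2) atTop atTop :=
    tendsto_atTop_add_const_left _ _ (tendsto_pow_atTop two_ne_zero)
  have hlim : Tendsto (fun r : ℝ => (1/2) * g (τ + r ^ 2)) atTop (𝓝 ((1/2) * 0)) := by
    apply Tendsto.const_mul
    have : Tendsto g atTop (𝓝 0) :=
      (hc.is_zero_at_infty).mono_left atTop_le_cocompact
    exact this.comp hti
  have I2 := integral_Ioi_of_hasDerivAt_of_tendsto' (a := 0)
    (f := fun r : ℝ => (1/2) * g (τ + r ^ 2)) (f' := fun r => r * deriv g (τ + r ^ 2))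
    (m := (1/2) * 0) ?_ ?_ hlim
  · rw [I1] at I2
    simp at I2
    exact I2
  · intro x _
    have h1 : HasDerivAt (fun r : ℝ => τ + r ^ 2) (2 * x) x := by
      simpa using (hasDerivAt_pow 2 x).const_add τ
    have h2 := ((hdiff (τ + x ^ 2)).hasDerivAt.comp x h1).const_mul (1/2)
    exact h2.congr_deriv (by ring)
  · apply Integrable.integrableOn
    apply Continuous.integrable_of_hasCompactSupport
    · fun_prop
    · apply HasCompactSupport.intro
        (K := Metric.closedBall (0 : ℝ) (|R| + |τ| + 1)) (isCompact_closedBall _ _)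
      intro p hp
      rw [hz, mul_zero]
      rw [mem_closedBall_zero_iff, Real.norm_eq_abs] at hp
      have a1 := le_abs_self R
      have a2 := neg_abs_le τ
      have a3 := abs_nonneg R
      have a4 := abs_nonneg τ
      refine lt_of_lt_of_le ?_ (le_abs_self _)
      nlinarith [sq_abs p]

/-- Sign argument: if `c · (Abel g)''` is nonpositive on `(-∞, M)`, then `g = 0`. -/
lemma abel_sign {M c : ℝ} (hc : c ≠ 0) {g : ℝ → ℝ} (hg : ContDiff ℝ 2 g)
    (hgs : ∀ s, M < |s| → g s = 0)
    (hneg : ∀ σ, σ < M → c * deriv (deriv (abelT g)) σ ≤ 0) (τ : ℝ) : g τ = 0 := by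
  have hcs : HasCompactSupport g := by
    apply HasCompactSupport.intro (K := Set.Icc (-M) M) isCompact_Icc
    intro x hx
    apply hgs
    by_contra h
    exact hx (abs_le.1 (not_lt.1 h))
  have hg1 : ContDiff ℝ 1 g := hg.of_le (by norm_num)
  have hd1 : ContDiff ℝ 1 (deriv g) := by
    have : ContDiff ℝ (1 + 1) g := by simpa [one_add_one_eq_two] using hg
    exact (contDiff_succ_iff_deriv.1 this).2.2
  have hds : ∀ s, M < |s| → deriv g s = 0 := by
    intro s hs
    have : g =ᶠ[𝓝 s] fun _ => 0 := by
      filter_upwards [(isOpen_lt continuous_const continuous_abs).mem_nhds hs] with x hx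
      exact hgs x hx
    rw [this.deriv_eq, deriv_const]
  have e1 : deriv (abelT g) = abelT (deriv g) := by
    ext σ; exact (abelT_hasDerivAt hcs hg1 σ).deriv
  rw [e1] at hneg
  have hdiff : Differentiable ℝ (abelT (deriv g)) := fun σ =>
    (abelT_hasDerivAt hcs.deriv hd1 σ).differentiableAt
  have hanti : AntitoneOn (fun σ => c * abelT (deriv g) σ) (Set.Iic M) := by
    apply antitoneOn_of_deriv_nonpos (convex_Iic M)
    · exact (hdiff.continuous.const_mul c |>.continuousOn)
    · exact (hdiff.const_mul c).differentiableOn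
    · intro x hx
      rw [interior_Iic] at hx
      rw [deriv_const_mul _ (hdiff x)]
      exact hneg x hx
  have hright : ∀ σ, M ≤ σ → abelT (deriv g) σ = 0 := fun σ h =>
    abelT_zero_right (fun s hs => hds s (lt_of_lt_of_le hs (le_abs_self s))) h
  have hlim : Tendsto (fun σ => c * abelT (deriv g) σ) atBot (𝓝 0) := by
    simpa using (abelT_tendsto hd1.continuous hds).const_mul c
  apply abel_inj hcs hg1
  intro σ
  rcases le_or_gt M σ with h | h
  · exact hright σ h
  · have h1 : 0 ≤ c * abelT (deriv g) σ := by
      have := hanti (Set.mem_Iic.2 h.le) (Set.mem_Iic.2 le_rfl) h.le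
      simpa [hright M le_rfl] using this
    have h2 : c * abelT (deriv g) σ ≤ 0 := by
      apply ge_of_tendsto hlim
      filter_upwards [eventually_le_atBot σ] with x hx
      exact hanti (Set.mem_Iic.2 (hx.trans h.le)) (Set.mem_Iic.2 h.le) hx
    have := le_antisymm h2 h1
    exact (mul_eq_zero.1 this).resolve_left hc

/-! ### The Radon transform -/

/-- Rotated coordinates. -/
noncomputable def rotP (θ s t : ℝ) : ℝ × ℝ :=
  (s * Real.cos θ - t * Real.sin θ, s * Real.sin θ + t * Real.cos θ)

lemma radon_eq (v : ℝ × ℝ → ℝ) (s θ : ℝ) : radon v s θ = ∫ t : ℝ, v (rotP θ s t) := rfl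

lemma rotP_sq (θ s t : ℝ) : (rotP θ s t).1 ^ 2 + (rotP θ s t).2 ^ 2 = s ^ 2 + t ^ 2 := by
  simp only [rotP]
  linear_combination (s ^ 2 + t ^ 2) * Real.sin_sq_add_cos_sq θ

lemma rotP_zero {M : ℝ} (hM : 0 < M) {v : ℝ × ℝ → ℝ} (hv : SuppIn M v) {θ s t : ℝ}
    (h : M < |s| ∨ M < |t|) : v (rotP θ s t) = 0 := by
  apply hv
  rw [rotP_sq]
  rcases h with h | h
  · nlinarith [sq_abs s, sq_nonneg t]
  · nlinarith [sq_abs t, sq_nonneg s]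

lemma radon_zero {M : ℝ} (hM : 0 < M) {v : ℝ × ℝ → ℝ} (hv : SuppIn M v) (θ : ℝ) {s : ℝ}
    (h : M < |s|) : radon v s θ = 0 := by
  rw [radon_eq]
  simp [rotP_zero hM hv (Or.inl h)]

lemma radon_set {M : ℝ} (hM : 0 < M) {v : ℝ × ℝ → ℝ} (hv : SuppIn M v) (s θ : ℝ) :
    radon v s θ = ∫ t in Set.Icc (-M) M, v (rotP θ s t) := by
  rw [radon_eq]
  symm
  apply setIntegral_eq_integral_of_forall_compl_eq_zero
  intro t ht
  apply rotP_zero hM hv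
  right
  by_contra h
  exact ht (abs_le.1 (not_lt.1 h))

lemma radon_continuous {M : ℝ} (hM : 0 < M) {v : ℝ × ℝ → ℝ} (hv : SuppIn M v)
    (hc : Continuous v) : Continuous (fun p : ℝ × ℝ => radon v p.1 p.2) := by
  simp only [radon_set hM hv]
  apply continuous_parametric_integral_of_continuous (f := fun (p : ℝ × ℝ) t => v (rotP p.2 p.1 t))
  · simp only [Function.uncurry_def, rotP]
    fun_prop
  · exact isCompact_Icc

lemma SuppIn.hcs {M : ℝ} {v : ℝ × ℝ → ℝ} (hv : SuppIn M v) : HasCompactSupport v := by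
  apply HasCompactSupport.intro
    (K := Metric.closedBall (0 : ℝ × ℝ) |M|) (isCompact_closedBall _ _)
  intro p hp
  apply hv
  rw [mem_closedBall_zero_iff, Prod.norm_def, max_le_iff, not_and_or, Real.norm_eq_abs,
    Real.norm_eq_abs] at hp
  rw [← sq_abs M]
  have := abs_nonneg M
  rcases hp with hp | hp
  · nlinarith [sq_abs p.1, sq_nonneg p.2]
  · nlinarith [sq_abs p.2, sq_nonneg p.1]

/-- Directional derivative. -/
noncomputable def dd (w : ℝ × ℝ) (v : ℝ × ℝ → ℝ) : ℝ × ℝ → ℝ := fun x => fderiv ℝ v x w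

lemma dd_supp {M : ℝ} {v : ℝ × ℝ → ℝ} (hv : SuppIn M v) (w : ℝ × ℝ) : SuppIn M (dd w v) := by
  intro x hx
  have : v =ᶠ[𝓝 x] fun _ => 0 := by
    have ho : IsOpen {y : ℝ × ℝ | M ^ 2 < y.1 ^ 2 + y.2 ^ 2} :=
      isOpen_lt (by fun_prop) (by fun_prop)
    filter_upwards [ho.mem_nhds hx] with y hy
    exact hv y hy
  simp [dd, this.fderiv_eq]

lemma dd_smooth {v : ℝ × ℝ → ℝ} (hv : ContDiff ℝ (⊤ : ℕ∞) v) (w : ℝ × ℝ) :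
    ContDiff ℝ (⊤ : ℕ∞) (dd w v) := by
  unfold dd
  exact (hv.fderiv_right (m := (⊤ : ℕ∞)) (by simp)).clm_apply contDiff_const

lemma rot_integrable {M : ℝ} (hM : 0 < M) {v : ℝ × ℝ → ℝ} (hv : SuppIn M v)
    (hc : Continuous v) (θ s : ℝ) : Integrable (fun t => v (rotP θ s t)) := by
  apply Continuous.integrable_of_hasCompactSupport
  · unfold rotP; fun_prop
  · apply HasCompactSupport.intro (K := Set.Icc (-M) M) isCompact_Icc
    intro t ht
    apply rotP_zero hM hv
    right
    by_contra h
    exact ht (abs_le.1 (not_lt.1 h))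

lemma radon_hasDerivAt {M : ℝ} (hM : 0 < M) {v : ℝ × ℝ → ℝ} (hv : SuppIn M v)
    (hsm : ContDiff ℝ (⊤ : ℕ∞) v) (θ s : ℝ) :
    HasDerivAt (fun s => radon v s θ)
      (radon (dd (Real.cos θ, Real.sin θ) v) s θ) s := by
  set w : ℝ × ℝ := (Real.cos θ, Real.sin θ) with hw
  have hdc : Continuous (dd w v) := (dd_smooth hsm w).continuous
  obtain ⟨C, hC⟩ := (dd_supp hv w).hcs.exists_bound_of_continuous hdc
  have key := hasDerivAt_integral_of_dominated_loc_of_deriv_le (μ := volume) (x₀ := s)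
    (s := Set.univ)
    (F := fun s t => v (rotP θ s t)) (F' := fun s t => dd w v (rotP θ s t))
    (bound := Set.indicator (Set.Icc (-M) M) (fun _ => C)) Filter.univ_mem
    (Eventually.of_forall fun x => (rot_integrable hM hv hsm.continuous θ x).aestronglyMeasurable)
    (rot_integrable hM hv hsm.continuous θ s)
    (rot_integrable hM (dd_supp hv w) hdc θ s).aestronglyMeasurable
    (Eventually.of_forall ?_) ?_ (Eventually.of_forall ?_)
  · exact key.2
  · intro t x _
    by_cases ht : t ∈ Set.Icc (-M) M
    · rw [Set.indicator_of_mem ht]; exact hC _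
    · rw [Set.indicator_of_notMem ht, rotP_zero hM (dd_supp hv w), norm_zero]
      right
      by_contra h
      exact ht (abs_le.1 (not_lt.1 h))
  · rw [integrable_indicator_iff measurableSet_Icc]
    exact integrableOn_const isCompact_Icc.measure_lt_top.ne
  · intro t x _
    have h1 : HasDerivAt (fun s => rotP θ s t) w x := by
      unfold rotP
      apply HasDerivAt.prodMk
      · simpa using ((hasDerivAt_id x).mul_const (Real.cos θ)).sub_const (t * Real.sin θ)
      · simpa using ((hasDerivAt_id x).mul_const (Real.sin θ)).add_const (t * Real.cos θ)
    have h2 : HasFDerivAt v (fderiv ℝ v (rotP θ x t)) (rotP θ x t) :=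
      (hsm.differentiable (by simp) _).hasFDerivAt
    exact h2.comp_hasDerivAt x h1

lemma radon_contDiff {M : ℝ} (hM : 0 < M) (θ : ℝ) (n : ℕ) : ∀ {v : ℝ × ℝ → ℝ}, SuppIn M v →
    ContDiff ℝ (⊤ : ℕ∞) v → ContDiff ℝ n (fun s => radon v s θ) := by
  induction n with
  | zero =>
    intro v hv hsm
    rw [Nat.cast_zero, contDiff_zero]
    exact (radon_continuous hM hv hsm.continuous).comp (by fun_prop : Continuous fun s => (s, θ))
  | succ n ih =>
    intro v hv hsm
    rw [Nat.cast_succ, contDiff_succ_iff_deriv]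
    refine ⟨fun s => (radon_hasDerivAt hM hv hsm θ s).differentiableAt, by simp, ?_⟩
    have : deriv (fun s => radon v s θ)
        = fun s => radon (dd (Real.cos θ, Real.sin θ) v) s θ := by
      ext s; exact (radon_hasDerivAt hM hv hsm θ s).deriv
    rw [this]
    exact ih (dd_supp hv _) (dd_smooth hsm _)

lemma radon_dd {M : ℝ} (hM : 0 < M) {v : ℝ × ℝ → ℝ} (hv : SuppIn M v)
    (hsm : ContDiff ℝ (⊤ : ℕ∞) v) (θ s : ℝ) :
    radon (dd (Real.cos θ, Real.sin θ) v) s θ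
      = Real.cos θ * radon (dd (1, 0) v) s θ + Real.sin θ * radon (dd (0, 1) v) s θ := by
  simp only [radon_eq]
  rw [← integral_const_mul, ← integral_const_mul, ← integral_add]
  · congr 1
    ext t
    simp only [dd]
    rw [← smul_eq_mul, ← smul_eq_mul, ← map_smul, ← map_smul, ← map_add]
    simp
  · exact (rot_integrable hM (dd_supp hv _) (dd_smooth hsm _).continuous θ s).const_mul _
  · exact (rot_integrable hM (dd_supp hv _) (dd_smooth hsm _).continuous θ s).const_mul _

lemma radon_symm (v : ℝ × ℝ → ℝ) (s θ : ℝ) : radon v (-s) (θ + π) = radon v s θ := by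
  rw [radon_eq, radon_eq, ← integral_neg_eq_self]
  congr 1
  ext t
  simp only [rotP, Real.cos_add_pi, Real.sin_add_pi]
  congr 2 <;> ring

lemma rot_measurePreserving (θ : ℝ) :
    MeasurePreserving (fun p : ℝ × ℝ => rotP θ p.1 p.2) volume volume := by
  let A : Matrix (Fin 2) (Fin 2) ℝ := !![Real.cos θ, -Real.sin θ; Real.sin θ, Real.cos θ]
  let f : (ℝ × ℝ) →ₗ[ℝ] (ℝ × ℝ) :=
    Matrix.toLin (Module.Basis.finTwoProd ℝ) (Module.Basis.finTwoProd ℝ) A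
  have hdet : LinearMap.det f = 1 := by
    simp only [f, LinearMap.det_toLin, A, Matrix.det_fin_two_of]
    nlinarith [Real.sin_sq_add_cos_sq θ]
  have hf : ∀ p : ℝ × ℝ, f p = rotP θ p.1 p.2 := by
    intro p
    simp only [f, A, Matrix.toLin_finTwoProd_apply, rotP]
    ext <;> simp <;> ring
  have e : (fun p : ℝ × ℝ => rotP θ p.1 p.2) = f := by ext1 p; exact (hf p).symm
  rw [e]
  refine ⟨f.continuous_of_finiteDimensional.measurable, ?_⟩
  rw [Measure.map_linearMap_addHaar_eq_smul_addHaar _ (by rw [hdet]; exact one_ne_zero), hdet]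
  simp

lemma rot_embedding (θ : ℝ) : MeasurableEmbedding (fun p : ℝ × ℝ => rotP θ p.1 p.2) := by
  apply Continuous.measurableEmbedding
  · unfold rotP; fun_prop
  · rintro ⟨a, b⟩ ⟨c, d⟩ h
    simp only [rotP, Prod.mk.injEq] at h
    obtain ⟨h1, h2⟩ := h
    have := Real.sin_sq_add_cos_sq θ
    ext
    · simp only
      linear_combination Real.cos θ * h1 + Real.sin θ * h2 + (c - a) * this
    · simp only
      linear_combination -Real.sin θ * h1 + Real.cos θ * h2 + (d - b) * this

/-- The Fourier transform vanishes if the Radon transform does. -/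
lemma radon_fourier_zero {M : ℝ} {v : ℝ × ℝ → ℝ} (hv : SuppIn M v)
    (hc : Continuous v) (h : ∀ s θ, radon v s θ = 0) (L : StrongDual ℝ (ℝ × ℝ)) :
    ∫ x, (v x : ℂ) * Complex.exp (L x * Complex.I) = 0 := by
  obtain ⟨r, θ, hL⟩ : ∃ r θ : ℝ, ∀ x : ℝ × ℝ, L x = r * (Real.cos θ * x.1 + Real.sin θ * x.2) := by
    let z : ℂ := ⟨L (1, 0), L (0, 1)⟩
    refine ⟨‖z‖, Complex.arg z, fun x => ?_⟩
    have e1 : ‖z‖ * Real.cos (Complex.arg z) = L (1, 0) := Complex.norm_mul_cos_arg z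
    have e2 : ‖z‖ * Real.sin (Complex.arg z) = L (0, 1) := Complex.norm_mul_sin_arg z
    have : x = x.1 • (1, 0) + x.2 • (0, 1) := by ext <;> simp
    rw [mul_add, ← mul_assoc, ← mul_assoc, e1, e2]
    conv_lhs => rw [this]
    rw [map_add, map_smul, map_smul, smul_eq_mul, smul_eq_mul]
    ring
  rw [← (rot_measurePreserving θ).integral_comp (rot_embedding θ)]
  have hLr : ∀ s t, L (rotP θ s t) = r * s := by
    intro s t
    rw [hL]
    simp only [rotP]
    linear_combination r * s * Real.sin_sq_add_cos_sq θ
  simp only [hLr]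
  have hint : Integrable (fun p : ℝ × ℝ =>
      (v (rotP θ p.1 p.2) : ℂ) * Complex.exp (((r * p.1 : ℝ) : ℂ) * Complex.I)) := by
    have h1 : Integrable (fun x => (v x : ℂ) * Complex.exp (L x * Complex.I)) := by
      apply Continuous.integrable_of_hasCompactSupport
      · fun_prop
      · apply HasCompactSupport.mul_right
        exact hv.hcs.comp_left (g := fun x : ℝ => (x : ℂ)) (by simp)
    have h2 := (rot_measurePreserving θ).integrable_comp_of_integrable h1
    simpa only [Function.comp_def, hLr] using h2
  rw [Measure.volume_eq_prod, integral_prod _ hint]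
  have : ∀ s : ℝ, ∫ t : ℝ, (v (rotP θ s t) : ℂ) * Complex.exp (((r * s : ℝ) : ℂ) * Complex.I) = 0 := by
    intro s
    rw [integral_mul_const, integral_complex_ofReal, ← radon_eq, h]
    simp
  simp only [this, integral_zero]

lemma radon_inj {M : ℝ} {v : ℝ × ℝ → ℝ} (hv : SuppIn M v)
    (hc : Continuous v) (h : ∀ s θ, radon v s θ = 0) : v = 0 := by
  have hi : Integrable v := hc.integrable_of_hasCompactSupport hv.hcs
  let μ := volume.withDensity (fun x => ENNReal.ofReal (v x))
  let ν := volume.withDensity (fun x => ENNReal.ofReal (-v x))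
  have : IsFiniteMeasure μ := isFiniteMeasure_withDensity_ofReal hi.2
  have : IsFiniteMeasure ν := isFiniteMeasure_withDensity_ofReal hi.neg.2
  have hμν : μ = ν := by
    apply Measure.ext_of_charFunDual
    ext L
    rw [charFunDual_apply, charFunDual_apply]
    have h0 := radon_fourier_zero hv hc h L
    simp only [μ, ν]
    have m1 : Measurable (fun x => Real.toNNReal (v x)) := hc.measurable.real_toNNReal
    have m2 : Measurable (fun x => Real.toNNReal (-v x)) := hc.measurable.neg.real_toNNReal
    have hi1 : Integrable (fun x => Real.toNNReal (v x) • Complex.exp (L x * Complex.I)) := by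
      apply Continuous.integrable_of_hasCompactSupport
      · fun_prop
      · apply HasCompactSupport.smul_right
        exact hv.hcs.comp_left (g := fun x : ℝ => ((Real.toNNReal x : NNReal) : ℝ)) (by simp)
    have hi2 : Integrable (fun x => Real.toNNReal (-v x) • Complex.exp (L x * Complex.I)) := by
      apply Continuous.integrable_of_hasCompactSupport
      · fun_prop
      · apply HasCompactSupport.smul_right
        exact hv.hcs.comp_left (g := fun x : ℝ => ((Real.toNNReal (-x) : NNReal) : ℝ)) (by simp)
    simp only [ENNReal.ofReal]
    rw [integral_withDensity_eq_integral_smul m1, integral_withDensity_eq_integral_smul m2,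
      ← sub_eq_zero, ← integral_sub hi1 hi2, ← h0]
    congr 1
    ext x
    simp only [NNReal.smul_def, Complex.real_smul]
    rw [← sub_mul, ← Complex.ofReal_sub]
    congr 2
    rw [Real.coe_toNNReal', Real.coe_toNNReal', max_comm, max_comm (-v x)]
    rcases le_total 0 (v x) with hx | hx <;> simp [hx]
  have hae := (withDensity_eq_iff hc.measurable.ennreal_ofReal.aemeasurable
    hc.measurable.neg.ennreal_ofReal.aemeasurable
    (by
      have := hi.2
      exact (lintegral_ofReal_le_lintegral_enorm v).trans_lt this |>.ne)).1 hμν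
  have hae' : v =ᵐ[volume] 0 := by
    filter_upwards [hae] with x hx
    simp only [Pi.zero_apply, Pi.neg_apply] at hx ⊢
    rcases lt_trichotomy (v x) 0 with h | h | h
    · rw [ENNReal.ofReal_of_nonpos h.le, eq_comm, ENNReal.ofReal_eq_zero] at hx
      linarith
    · exact h
    · rw [ENNReal.ofReal_of_nonpos (p := -v x) (by linarith), ENNReal.ofReal_eq_zero] at hx
      linarith
  exact (Continuous.ae_eq_iff_eq volume hc continuous_zero).1 hae'

/-! ### The cubic form on the light cone and the main argument -/

/-- The cubic form evaluated at `ω̂`. -/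
noncomputable def cubicN (e : Fin 3 → Fin 3 → Fin 3 → ℝ) (θ : ℝ) : ℝ :=
  ∑ i : Fin 3, ∑ j : Fin 3, ∑ k : Fin 3,
      e i j k * omegaHat θ i * omegaHat θ j * omegaHat θ k

lemma omegaHat_analytic (i : Fin 3) (x : ℝ) : AnalyticAt ℝ (fun θ => omegaHat θ i) x := by
  fin_cases i
  · exact analyticAt_const
  · exact Real.analyticAt_cos
  · exact Real.analyticAt_sin

lemma cubicN_analytic (e : Fin 3 → Fin 3 → Fin 3 → ℝ) : AnalyticOnNhd ℝ (cubicN e) Set.univ := by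
  intro x _
  unfold cubicN
  refine Finset.analyticAt_fun_sum _ fun i _ => Finset.analyticAt_fun_sum _ fun j _ =>
    Finset.analyticAt_fun_sum _ fun k _ => ?_
  exact ((analyticAt_const.mul (omegaHat_analytic i x)).mul (omegaHat_analytic j x)).mul
    (omegaHat_analytic k x)

lemma cubicN_ne {e : Fin 3 → Fin 3 → Fin 3 → ℝ} (h : NullCondFails e) : ∃ θ, cubicN e θ ≠ 0 := by
  obtain ⟨ξ, h1, h2, h3⟩ := h
  have h0 : ξ 0 ≠ 0 := by
    intro h0
    rw [h0] at h1
    have a := sq_nonneg (ξ 1)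
    have b := sq_nonneg (ξ 2)
    have c1 : ξ 1 = 0 := pow_eq_zero_iff two_ne_zero |>.1 (by linarith)
    have c2 : ξ 2 = 0 := pow_eq_zero_iff two_ne_zero |>.1 (by linarith)
    rcases h2 with h2 | h2
    · exact h2 c1
    · exact h2 c2
  let z : ℂ := ⟨-ξ 1 / ξ 0, -ξ 2 / ξ 0⟩
  have hz : ‖z‖ = 1 := by
    rw [← sq_eq_sq₀ (norm_nonneg _) zero_le_one, ← Complex.normSq_eq_norm_sq, Complex.normSq_mk]
    field_simp
    linarith
  have e1 : Real.cos (Complex.arg z) = -ξ 1 / ξ 0 := by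
    have := Complex.norm_mul_cos_arg z
    rwa [hz, one_mul] at this
  have e2 : Real.sin (Complex.arg z) = -ξ 2 / ξ 0 := by
    have := Complex.norm_mul_sin_arg z
    rwa [hz, one_mul] at this
  refine ⟨Complex.arg z, fun hN => h3 ?_⟩
  have hξ : ∀ i, ξ i = -ξ 0 * omegaHat (Complex.arg z) i := by
    intro i
    fin_cases i
    · simp [omegaHat]
    · simp only [omegaHat, e1]; simp; field_simp
    · simp only [omegaHat, e2]; simp; field_simp
  have : ∑ i : Fin 3, ∑ j : Fin 3, ∑ k : Fin 3, e i j k * ξ i * ξ j * ξ k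
      = (-ξ 0) ^ 3 * cubicN e (Complex.arg z) := by
    unfold cubicN
    simp only [Finset.mul_sum]
    refine Finset.sum_congr rfl fun i _ => Finset.sum_congr rfl fun j _ =>
      Finset.sum_congr rfl fun k _ => ?_
    rw [hξ i, hξ j, hξ k]
    generalize omegaHat (Complex.arg z) = w
    generalize ξ 0 = a
    ring
  rw [this, hN, mul_zero]

/-- The function `R(s,ω;φ₁) − ∂_s R(s,ω;φ₀)`. -/
noncomputable def srcG (φ0 φ1 : ℝ × ℝ → ℝ) (θ s : ℝ) : ℝ :=
  radon φ1 s θ - deriv (fun s' => radon φ0 s' θ) s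

lemma F0_eq_abel (φ0 φ1 : ℝ × ℝ → ℝ) (θ : ℝ) :
    (fun σ => F0 φ0 φ1 σ θ)
      = fun σ => (1 / (2 * Real.pi * Real.sqrt 2)) * abelT (srcG φ0 φ1 θ) σ := rfl

lemma F2_eq_abel (e : Fin 3 → Fin 3 → Fin 3 → ℝ) (φ0 φ1 : ℝ × ℝ → ℝ) (σ θ : ℝ) :
    F2 e φ0 φ1 σ θ = (cubicN e θ * (1 / (2 * Real.pi * Real.sqrt 2))) *
      deriv (deriv (abelT (srcG φ0 φ1 θ))) σ := by
  unfold F2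
  rw [F0_eq_abel]
  simp only [deriv_const_mul_field]
  rw [← cubicN]
  ring

lemma radon_periodic (v : ℝ × ℝ → ℝ) (s θ : ℝ) : radon v s (θ + 2 * π) = radon v s θ := by
  simp [radon]

/-- Step 1 in the proof of Lemma 2.1: the set
`D = {(σ,θ) ∈ (−∞,M)×[0,2π] : F₂(σ,θ) > 0}` is nonempty. -/
theorem F2_pos_set_nonempty
    (M : ℝ) (hM : 0 < M)
    (φ0 φ1 : ℝ × ℝ → ℝ)
    (hφ0 : ContDiff ℝ (⊤ : ℕ∞) φ0) (hφ1 : ContDiff ℝ (⊤ : ℕ∞) φ1)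
    (hs0 : SuppIn M φ0) (hs1 : SuppIn M φ1)
    (e : Fin 3 → Fin 3 → Fin 3 → ℝ)
    (hnull : NullCondFails e)
    (hne : φ0 ≠ 0 ∨ φ1 ≠ 0) :
    ∃ p : ℝ × ℝ, p.1 < M ∧ p.2 ∈ Set.Icc 0 (2 * Real.pi) ∧
      0 < F2 e φ0 φ1 p.1 p.2 := by
  by_contra hcon
  push Not at hcon
  have hg0 : ∀ θ s, deriv (fun s' => radon φ0 s' θ) s
      = radon (dd (Real.cos θ, Real.sin θ) φ0) s θ :=
    fun θ s => (radon_hasDerivAt hM hs0 hφ0 θ s).deriv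
  -- `g` vanishes for the good angles
  have step1 : ∀ θ ∈ Set.Icc 0 (2 * π), cubicN e θ ≠ 0 → ∀ s, srcG φ0 φ1 θ s = 0 := by
    intro θ hθ hN s
    have hc : cubicN e θ * (1 / (2 * Real.pi * Real.sqrt 2)) ≠ 0 := by
      apply mul_ne_zero hN
      positivity
    have hsm : ContDiff ℝ 2 (srcG φ0 φ1 θ) := by
      unfold srcG
      simp only [hg0]
      exact (radon_contDiff hM θ 2 hs1 hφ1).sub
        (radon_contDiff hM θ 2 (dd_supp hs0 _) (dd_smooth hφ0 _))
    apply abel_sign (M := M) hc hsm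
    · intro s hs
      unfold srcG
      rw [hg0, radon_zero hM hs1 θ hs, radon_zero hM (dd_supp hs0 _) θ hs, sub_zero]
    · intro σ hσ
      rw [← F2_eq_abel]
      exact hcon (σ, θ) hσ hθ
  have step2 : ∀ θ, cubicN e θ ≠ 0 → ∀ s, srcG φ0 φ1 θ s = 0 := by
    intro θ hN s
    have hper : Function.Periodic (fun θ => (cubicN e θ, srcG φ0 φ1 θ)) (2 * π) := by
      intro θ
      simp only [Prod.mk.injEq]
      constructor
      · simp [cubicN, omegaHat]
      · ext s
        simp only [srcG, radon_periodic]
    obtain ⟨y, hy, hxy⟩ := hper.exists_mem_Ico₀ Real.two_pi_pos θ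
    simp only [Prod.mk.injEq] at hxy
    rw [hxy.2]
    exact step1 y ⟨hy.1, hy.2.le⟩ (hxy.1 ▸ hN) s
  -- and by density for all angles
  have step3 : ∀ θ s, srcG φ0 φ1 θ s = 0 := by
    intro θ s
    have hcont : Continuous (fun θ => srcG φ0 φ1 θ s) := by
      simp only [srcG, hg0, radon_dd hM hs0 hφ0]
      have hp : Continuous fun θ : ℝ => (s, θ) := by fun_prop
      have c1 := (radon_continuous hM hs1 hφ1.continuous).comp hp
      have c2 := (radon_continuous hM (dd_supp hs0 (1, 0)) (dd_smooth hφ0 _).continuous).comp hp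
      have c3 := (radon_continuous hM (dd_supp hs0 (0, 1)) (dd_smooth hφ0 _).continuous).comp hp
      exact c1.sub ((Real.continuous_cos.mul c2).add (Real.continuous_sin.mul c3))
    have hev : ∀ᶠ x in 𝓝[≠] θ, cubicN e x ≠ 0 := by
      by_contra hf
      have hfr : ∃ᶠ x in 𝓝[≠] θ, cubicN e x = 0 := by
        intro h; exact hf h
      have := (cubicN_analytic e).eqOn_zero_of_preconnected_of_frequently_eq_zero
        isPreconnected_univ (Set.mem_univ θ) hfr
      obtain ⟨θ', hθ'⟩ := cubicN_ne hnull
      exact hθ' (this (Set.mem_univ θ'))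
    have ht : Tendsto (fun θ => srcG φ0 φ1 θ s) (𝓝[≠] θ) (𝓝 (srcG φ0 φ1 θ s)) :=
      hcont.continuousAt.tendsto.mono_left nhdsWithin_le_nhds
    have ht0 : Tendsto (fun θ => srcG φ0 φ1 θ s) (𝓝[≠] θ) (𝓝 0) := by
      apply tendsto_const_nhds.congr'
      filter_upwards [hev] with x hx
      exact (step2 x hx s).symm
    exact tendsto_nhds_unique ht ht0
  -- symmetry separates the two parts
  have hsymd : ∀ θ s, deriv (fun s' => radon φ0 s' (θ + π)) (-s)
      = - deriv (fun s' => radon φ0 s' θ) s := by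
    intro θ s
    have h1 : (fun s' => radon φ0 s' θ) = fun s' => (fun x => radon φ0 x (θ + π)) (-s') := by
      ext s'; exact (radon_symm φ0 s' θ).symm
    rw [h1, deriv_comp_neg (fun x => radon φ0 x (θ + π)) s, neg_neg]
  have hR1 : ∀ s θ, radon φ1 s θ = 0 := by
    intro s θ
    have a := step3 θ s
    have b := step3 (θ + π) (-s)
    simp only [srcG] at a b
    rw [radon_symm, hsymd] at b
    linarith
  have hD0 : ∀ s θ, deriv (fun s' => radon φ0 s' θ) s = 0 := by
    intro s θ
    have a := step3 θ s
    simp only [srcG, hR1] at a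
    linarith
  have hR0 : ∀ s θ, radon φ0 s θ = 0 := by
    intro s θ
    have hd : Differentiable ℝ (fun s' => radon φ0 s' θ) :=
      fun x => (radon_hasDerivAt hM hs0 hφ0 θ x).differentiableAt
    have := is_const_of_deriv_eq_zero hd (fun x => hD0 x θ) s (M + 1)
    rw [this]
    apply radon_zero hM hs0
    rw [abs_of_pos (by linarith)]
    linarith
  rcases hne with h | h
  · exact h (radon_inj hs0 hφ0.continuous hR0)
  · exact h (radon_inj hs1 hφ1.continuous hR1)
end
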